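/- arXiv:2412.02337 — 2 statements merged into one kernel-verified Lean document; each statement's English description precedes it below -/
import Mathlib

section
/- Let σ ≤ 0, d > 0, and θ be fixed real numbers, and set D = e^{2πi/8}·d^{1/2−σ} and F_m(x) = d·x·log(e·m/(d·x)) + θ·x. Then there exists a constant C > 1 (depending on σ, d, θ) such that for all positive integers M, N with M ≥ C·N: Σ_{n=1}^N ζ(σ + 2πidn)·e^{2πiθn}/n^{1−σ} = D · Σ_{m=1}^M (1/m^{1−σ}) · Σ_{n=1}^N e^{2πi·F_m(n)}/n^{1/2} + O(1), where the implied constant depends only on σ, d, θ. -/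
/-- `Fm d θ m u = d·u·log(e·m/(d·u)) + θ·u`. -/
noncomputable def Fm (d θ : ℝ) (m : ℕ) (u : ℝ) : ℝ :=
  d * u * Real.log (Real.exp 1 * m / (d * u)) + θ * u

open Filter Topology

lemma exists_g : ∃ (g : ℂ → ℂ) (ε K : ℝ), 0 < ε ∧ 0 < K ∧
    (∀ z, ‖z‖ < ε → z ≠ 0 → Complex.exp (-z) - 1 ≠ 0 ∧ (g z - 1 / z) * (Complex.exp (-z) - 1) = 1) ∧
    (∀ z, ‖z‖ < ε → ‖g z‖ ≤ K) ∧
    (∀ z y, ‖z‖ < ε → ‖y‖ < ε → ‖g z - g y‖ ≤ K * ‖z - y‖) := by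
  let E : ℂ → ℂ := fun z => Complex.exp (-z)
  have hE : Differentiable ℂ E := by fun_prop
  let φ : ℂ → ℂ := dslope E 0
  have hφ : Differentiable ℂ φ := by
    rw [← differentiableOn_univ]
    exact (Complex.differentiableOn_dslope univ_mem).2 hE.differentiableOn
  let ψ : ℂ → ℂ := dslope φ 0
  have hψ : Differentiable ℂ ψ := by
    rw [← differentiableOn_univ]
    exact (Complex.differentiableOn_dslope univ_mem).2 hφ.differentiableOn
  have hφ0 : φ 0 = -1 := by
    have h : HasDerivAt E (-1) 0 := by
      have := (hasDerivAt_neg (0:ℂ)).cexp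
      simpa using this
    simp only [φ, dslope_same]; exact h.deriv
  have e1 : ∀ z, z * φ z = E z - 1 := by
    intro z
    have := sub_smul_dslope E 0 z
    simpa [E] using this
  have e2 : ∀ z, z * ψ z = φ z + 1 := by
    intro z
    have := sub_smul_dslope φ 0 z
    rw [hφ0] at this
    simpa using this
  have hne : ∀ᶠ z in 𝓝 (0:ℂ), φ z ≠ 0 :=
    hφ.continuous.continuousAt.eventually_ne (by rw [hφ0]; norm_num)
  let g : ℂ → ℂ := fun z => ψ z / φ z
  have han : AnalyticAt ℂ g 0 :=
    (hψ.analyticAt 0).div (hφ.analyticAt 0) (by rw [hφ0]; norm_num)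
  obtain ⟨K, s, hs, hL⟩ := (han.contDiffAt (n := 1)).exists_lipschitzOnWith
  obtain ⟨ε, hε, hb⟩ := Metric.eventually_nhds_iff.1 (hne.and (eventually_mem_set.2 hs))
  have hb' : ∀ z : ℂ, ‖z‖ < ε → φ z ≠ 0 ∧ z ∈ s := fun z hz => hb (by simpa using hz)
  have hLL : ∀ z y, ‖z‖ < ε → ‖y‖ < ε → ‖g z - g y‖ ≤ K * ‖z - y‖ := by
    intro z y hz hy
    exact hL.norm_sub_le (hb' z hz).2 (hb' y hy).2
  refine ⟨g, ε, K + ‖g 0‖ + K * ε + 1, hε, by positivity, ?_, ?_, ?_⟩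
  · intro z hz h0
    have h1 := (hb' z hz).1
    have e3 : Complex.exp (-z) - 1 = z * φ z := (e1 z).symm
    rw [e3]
    refine ⟨mul_ne_zero h0 h1, ?_⟩
    simp only [g]
    field_simp
    linear_combination e2 z
  · intro z hz
    have h1 := hLL z 0 hz (by simpa using hε)
    have h2 : ‖g z‖ ≤ ‖g z - g 0‖ + ‖g 0‖ := by simpa using norm_add_le (g z - g 0) (g 0)
    have h3 : (K:ℝ) * ‖z - 0‖ ≤ K * ε := by
      gcongr; simpa using hz.le
    have : (0:ℝ) ≤ K := K.2
    linarith
  · intro z y hz hy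
    refine (hLL z y hz hy).trans ?_
    gcongr
    have : (0:ℝ) ≤ K * ε := by positivity
    have := norm_nonneg (g 0)
    linarith

lemma tail_bound : ∃ (ε K : ℝ), 0 < ε ∧ 0 < K ∧ ∀ (w : ℂ) (M L : ℕ), 1 ≤ w.re → w ≠ 1 → 1 ≤ M → M ≤ L →
    ‖w‖ ≤ ε * M → ‖∑ m ∈ Finset.Ico M L, (m : ℂ) ^ (-w)‖ ≤ K / ‖w - 1‖ := by
  obtain ⟨g, ε, K, hε, hK, hg, hgb, hgL⟩ := exists_g
  refine ⟨min (ε/2) 1, 6*K + 4, by positivity, by positivity, ?_⟩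
  intro w M L hw hw1 hM hML hwM
  have hwn : 1 ≤ ‖w‖ := hw.trans (Complex.re_le_norm w)
  have hwpos : 0 < ‖w‖ := by linarith
  have hw0 : w ≠ 0 := norm_pos_iff.1 hwpos
  have hMr : (1:ℝ) ≤ M := by exact_mod_cast hM
  have hwM1 : ‖w‖ ≤ ε/2 * M := hwM.trans (by gcongr; exact min_le_left _ _)
  have hwM2 : ‖w‖ ≤ M := hwM.trans (by
    calc _ ≤ 1 * (M:ℝ) := by gcongr; exact min_le_right _ _
      _ = _ := one_mul _)
  let lam : ℕ → ℝ := fun m => Real.log (1 + 1 / m)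
  have lam_pos : ∀ m, M ≤ m → 0 < lam m := by
    intro m hm
    have : (0:ℝ) < m := by exact_mod_cast (by omega : 0 < m)
    exact Real.log_pos (by have : 0 < 1 / (m:ℝ) := by positivity
                           linarith)
  have lam_le : ∀ m, M ≤ m → lam m ≤ 1 / m := by
    intro m hm
    have : (0:ℝ) < m := by exact_mod_cast (by omega : 0 < m)
    have := Real.log_le_sub_one_of_pos (x := 1 + 1 / (m:ℝ)) (by positivity)
    simpa [lam] using this
  have lam_anti : ∀ m, M ≤ m → lam (m+1) ≤ lam m := by
    intro m hm
    have : (0:ℝ) < m := by exact_mod_cast (by omega : 0 < m)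
    apply Real.log_le_log (by positivity)
    gcongr
    push_cast; linarith
  have lam_mul : ∀ m, M ≤ m → ‖w‖ * lam m < ε := by
    intro m hm
    have h0 : (M:ℝ) ≤ m := by exact_mod_cast hm
    have h1 : (0:ℝ) < m := by linarith
    calc ‖w‖ * lam m ≤ (ε/2 * M) * (1/m) := by
          gcongr
          · exact (lam_pos m hm).le
          · exact lam_le m hm
      _ ≤ (ε/2 * m) * (1/m) := by gcongr
      _ = ε/2 := by field_simp
      _ < ε := by linarith
  have lam_eps : ∀ m, M ≤ m → lam m < ε := fun m hm =>
    lt_of_le_of_lt (by nlinarith [lam_pos m hm]) (lam_mul m hm)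
  let u : ℕ → ℂ := fun m => (m : ℂ) ^ (-w)
  let e : ℕ → ℂ := fun m => g (-(lam m : ℂ)) / w + g (w * lam m)
  let c : ℕ → ℂ := fun m => -(m:ℂ) / w + e m
  have hr : ∀ m, M ≤ m → u (m+1) = u m * Complex.exp (-(w * lam m)) := by
    intro m hm
    have h1 : 0 < m := by omega
    have h1' : (0:ℝ) < m := by exact_mod_cast h1
    have hm0 : (m:ℂ) ≠ 0 := by exact_mod_cast h1.ne'
    have hm1 : ((m+1:ℕ):ℂ) ≠ 0 := by exact_mod_cast (Nat.succ_ne_zero m)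
    simp only [u]
    rw [Complex.cpow_def_of_ne_zero hm0, Complex.cpow_def_of_ne_zero hm1, ← Complex.exp_add]
    congr 1
    have : Real.log ((m+1:ℕ):ℝ) = Real.log m + lam m := by
      simp only [lam]
      rw [← Real.log_mul h1'.ne' (by positivity)]
      congr 1; push_cast; field_simp
    rw [← Complex.natCast_log, ← Complex.natCast_log, this]
    push_cast; ring
  have hc : ∀ m, M ≤ m → c m * (Complex.exp (-(w * lam m)) - 1) = 1 := by
    intro m hm
    have h1' : (0:ℝ) < m := by exact_mod_cast (by omega : 0 < m)
    have hl := lam_pos m hm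
    have hl0 : (lam m : ℂ) ≠ 0 := by exact_mod_cast hl.ne'
    have A := (hg (w * lam m) (by
      rw [norm_mul, Complex.norm_real, Real.norm_of_nonneg hl.le]; exact lam_mul m hm)
      (mul_ne_zero hw0 hl0)).2
    have B := (hg (-(lam m:ℂ)) (by
      rw [norm_neg, Complex.norm_real, Real.norm_of_nonneg hl.le]; exact lam_eps m hm)
      (neg_ne_zero.2 hl0)).2
    rw [neg_neg] at B
    have hexp : Complex.exp (lam m : ℂ) = 1 + 1 / m := by
      rw [← Complex.ofReal_exp]; simp only [lam]
      rw [Real.exp_log (by positivity)]; push_cast; rfl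
    rw [hexp] at B
    have hm0 : (m:ℂ) ≠ 0 := by exact_mod_cast h1'.ne'
    have B' : g (-(lam m:ℂ)) = m - 1 / lam m := by
      field_simp at B ⊢
      linear_combination B
    have : c m = g (w * lam m) - 1 / (w * lam m) := by
      simp only [c, e]; rw [B']; field_simp; ring
    rw [this]; exact A
  have un : ∀ m, M ≤ m → ‖u m‖ ≤ 1 / m := by
    intro m hm
    have h1 : 0 < m := by omega
    have h1' : (1:ℝ) ≤ m := by exact_mod_cast h1
    simp only [u]
    rw [Complex.norm_natCast_cpow_of_pos h1, one_div, ← Real.rpow_neg_one]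
    apply Real.rpow_le_rpow_of_exponent_le h1'
    simp; linarith
  have eb : ∀ m, M ≤ m → ‖e m‖ ≤ 2 * K := by
    intro m hm
    have hl := lam_pos m hm
    have A := hgb (w * lam m) (by
      rw [norm_mul, Complex.norm_real, Real.norm_of_nonneg hl.le]; exact lam_mul m hm)
    have B := hgb (-(lam m:ℂ)) (by
      rw [norm_neg, Complex.norm_real, Real.norm_of_nonneg hl.le]; exact lam_eps m hm)
    refine (norm_add_le _ _).trans ?_
    rw [norm_div]
    have : ‖g (-(lam m:ℂ))‖ / ‖w‖ ≤ K := by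
      rw [div_le_iff₀ hwpos]; nlinarith
    linarith
  have ed : ∀ m, M ≤ m → ‖e (m+1) - e m‖ ≤ 2 * K * ‖w‖ * (lam m - lam (m+1)) := by
    intro m hm
    have hm1 : M ≤ m + 1 := by omega
    have hl := lam_pos m hm
    have hl1 := lam_pos (m+1) hm1
    have hla := lam_anti m hm
    have A := hgL (w * lam (m+1)) (w * lam m) (by
      rw [norm_mul, Complex.norm_real, Real.norm_of_nonneg hl1.le]; exact lam_mul _ hm1) (by
      rw [norm_mul, Complex.norm_real, Real.norm_of_nonneg hl.le]; exact lam_mul m hm)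
    have B := hgL (-(lam (m+1):ℂ)) (-(lam m:ℂ)) (by
      rw [norm_neg, Complex.norm_real, Real.norm_of_nonneg hl1.le]; exact lam_eps _ hm1) (by
      rw [norm_neg, Complex.norm_real, Real.norm_of_nonneg hl.le]; exact lam_eps m hm)
    rw [← mul_sub, norm_mul, ← Complex.ofReal_sub, Complex.norm_real, Real.norm_of_nonpos (by linarith)] at A
    rw [show -(lam (m+1):ℂ) - -(lam m:ℂ) = ((lam m - lam (m+1) : ℝ) : ℂ) by push_cast; ring,
      Complex.norm_real, Real.norm_of_nonneg (by linarith)] at B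
    have : e (m+1) - e m = (g (-(lam (m+1):ℂ)) - g (-(lam m:ℂ))) / w
        + (g (w * lam (m+1)) - g (w * lam m)) := by simp only [e]; ring
    rw [this]
    refine (norm_add_le _ _).trans ?_
    rw [norm_div]
    have : ‖g (-(lam (m+1):ℂ)) - g (-(lam m:ℂ))‖ / ‖w‖ ≤ K * ‖w‖ * (lam m - lam (m+1)) := by
      rw [div_le_iff₀ hwpos]
      refine B.trans ?_
      have : 0 ≤ K * (lam m - lam (m+1)) := by apply mul_nonneg hK.le; linarith
      have h2 : 1 ≤ ‖w‖ * ‖w‖ := by nlinarith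
      nlinarith
    nlinarith
  have key : ∀ L, M ≤ L → (1 - 1/w) * ∑ m ∈ Finset.Ico M L, u m =
      u L * c L - u M * c M + (u L - u M) / w
        - ∑ m ∈ Finset.Ico M L, u (m+1) * (e (m+1) - e m) := by
    intro L hL
    induction L, hL using Nat.le_induction with
    | base => simp
    | succ n hn ih =>
      rw [Finset.sum_Ico_succ_top hn, Finset.sum_Ico_succ_top hn, mul_add, ih]
      have h1 := hc n hn
      have h2 := hr n hn
      have h3 : u n = u (n+1) * c n - u n * c n := by
        rw [h2]; linear_combination (-u n) * h1
      have h4 : c (n+1) - c n = -1/w + (e (n+1) - e n) := by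
        simp only [c]; push_cast; ring
      have h5 : e (n+1) - e n = c (n+1) - c n + 1/w := by rw [h4]; ring
      rw [h5]
      linear_combination h3
  have hsum : ∀ L, M ≤ L → ∑ m ∈ Finset.Ico M L, (lam m - lam (m+1)) = lam M - lam L := by
    intro L hL
    induction L, hL using Nat.le_induction with
    | base => simp
    | succ n hn ih => rw [Finset.sum_Ico_succ_top hn, ih]; ring
  have err : ‖∑ m ∈ Finset.Ico M L, u (m+1) * (e (m+1) - e m)‖ ≤ 2 * K / ‖w‖ := by
    calc _ ≤ ∑ m ∈ Finset.Ico M L, 1 / (M:ℝ) * (2 * K * ‖w‖ * (lam m - lam (m+1))) := by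
          apply norm_sum_le_of_le
          intro m hm
          have hm := (Finset.mem_Ico.1 hm).1
          rw [norm_mul]
          have hmr : (M:ℝ) ≤ ((m+1:ℕ):ℝ) := by exact_mod_cast (by omega)
          gcongr
          · exact (un (m+1) (by omega)).trans (by gcongr)
          · exact ed m hm
      _ = 1 / (M:ℝ) * (2 * K * ‖w‖ * (lam M - lam L)) := by
          rw [← Finset.mul_sum, ← Finset.mul_sum, hsum L hML]
      _ ≤ 1 / (M:ℝ) * (2 * K * ‖w‖ * (1 / M)) := by
          gcongr
          linarith [lam_le M le_rfl, lam_pos L hML]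
      _ ≤ 1 / ‖w‖ * (2 * K * ‖w‖ * (1 / ‖w‖)) := by gcongr
      _ = _ := by field_simp
  have ucb : ∀ m, M ≤ m → ‖u m * c m‖ ≤ (1 + 2 * K) / ‖w‖ := by
    intro m hm
    have h0 : (M:ℝ) ≤ m := by exact_mod_cast hm
    have h1 : (0:ℝ) < m := by linarith
    rw [norm_mul]
    calc _ ≤ 1 / (m:ℝ) * (m / ‖w‖ + 2 * K) := by
          gcongr
          · exact un m hm
          · refine (norm_add_le _ _).trans ?_
            rw [norm_div, norm_neg, Complex.norm_natCast]
            linarith [eb m hm]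
      _ = 1 / ‖w‖ + 2 * K * (1 / m) := by field_simp
      _ ≤ 1 / ‖w‖ + 2 * K * (1 / ‖w‖) := by gcongr; linarith
      _ = _ := by ring
  have uwb : ∀ m, M ≤ m → ‖u m‖ ≤ 1 := by
    intro m hm
    have h0 : (M:ℝ) ≤ m := by exact_mod_cast hm
    refine (un m hm).trans ?_
    rw [div_le_one (by linarith)]; linarith
  have hfin : ‖(1 - 1/w) * ∑ m ∈ Finset.Ico M L, u m‖ ≤ (6*K + 4) / ‖w‖ := by
    rw [key L hML]
    have h1 := ucb L hML
    have h2 := ucb M le_rfl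
    have h3 : ‖(u L - u M) / w‖ ≤ 2 / ‖w‖ := by
      rw [norm_div]; gcongr
      refine (norm_sub_le _ _).trans ?_
      linarith [uwb L hML, uwb M le_rfl]
    calc _ ≤ ‖u L * c L‖ + ‖u M * c M‖ + ‖(u L - u M) / w‖
          + ‖∑ m ∈ Finset.Ico M L, u (m+1) * (e (m+1) - e m)‖ := by
          refine (norm_sub_le _ _).trans ?_
          gcongr
          refine (norm_add_le _ _).trans ?_
          gcongr
          exact norm_sub_le _ _
      _ ≤ (1 + 2 * K) / ‖w‖ + (1 + 2 * K) / ‖w‖ + 2 / ‖w‖ + 2 * K / ‖w‖ := by gcongr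
      _ = _ := by ring
  have hw1' : 0 < ‖w - 1‖ := norm_pos_iff.2 (sub_ne_zero.2 hw1)
  rw [norm_mul, show 1 - 1/w = (w-1)/w by field_simp, norm_div] at hfin
  have : ‖∑ m ∈ Finset.Ico M L, u m‖ ≤ (6*K+4) / ‖w-1‖ := by
    rw [le_div_iff₀ hw1']
    rw [le_div_iff₀ hwpos] at hfin
    calc _ = ‖w - 1‖ / ‖w‖ * ‖∑ m ∈ Finset.Ico M L, u m‖ * ‖w‖ := by field_simp
      _ ≤ _ := hfin
  exact this

lemma zeta_approx : ∃ (ε K : ℝ), 0 < ε ∧ 0 < K ∧ ∀ (w : ℂ) (M : ℕ), 1 ≤ w.re → w ≠ 1 → 1 ≤ M →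
    ‖w‖ < ε * M → ‖riemannZeta w - ∑ m ∈ Finset.Ico 1 M, (m : ℂ) ^ (-w)‖ ≤ K / ‖w - 1‖ := by
  obtain ⟨ε, K, hε, hK, H⟩ := tail_bound
  refine ⟨ε, K, hε, hK, ?_⟩
  have main : ∀ (w : ℂ) (M : ℕ), 1 < w.re → w ≠ 1 → 1 ≤ M →
    ‖w‖ < ε * M → ‖riemannZeta w - ∑ m ∈ Finset.Ico 1 M, (m : ℂ) ^ (-w)‖ ≤ K / ‖w - 1‖ := by
    intro w M hw hw1 hM hwM
    have hs : Summable (fun n : ℕ => 1 / (n:ℂ) ^ w) := Complex.summable_one_div_nat_cpow.2 hw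
    have ht := hs.hasSum.tendsto_sum_nat
    rw [← zeta_eq_tsum_one_div_nat_cpow hw] at ht
    have hw0 : w ≠ 0 := by rintro rfl; simp at hw; linarith
    have ht2 := (ht.sub_const (∑ m ∈ Finset.Ico 1 M, (m : ℂ) ^ (-w))).norm
    refine le_of_tendsto ht2 ?_
    filter_upwards [eventually_ge_atTop M] with L hL
    have : ∑ m ∈ Finset.range L, 1 / (m:ℂ)^w = ∑ m ∈ Finset.Ico 1 L, (m:ℂ)^(-w) := by
      rw [Finset.range_eq_Ico, Finset.sum_eq_sum_Ico_succ_bot (by omega)]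
      simp [hw0, Complex.cpow_neg]
    rw [this, ← Finset.sum_Ico_consecutive _ hM hL, add_sub_cancel_left]
    exact H w M L hw.le hw1 hM hL hwM.le
  intro w M hw hw1 hM hwM
  have hcont : ContinuousAt (fun w : ℂ => ‖riemannZeta w - ∑ m ∈ Finset.Ico 1 M, (m : ℂ) ^ (-w)‖) w := by
    apply ContinuousAt.norm
    apply ContinuousAt.sub (differentiableAt_riemannZeta hw1).continuousAt
    apply tendsto_finsetSum
    intro m hm
    have : (m:ℂ) ≠ 0 := by
      have := (Finset.mem_Ico.1 hm).1
      exact_mod_cast (by omega : m ≠ 0)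
    exact ((continuousAt_const_cpow this).comp continuousAt_neg : ContinuousAt (fun w : ℂ => (m : ℂ) ^ (-w)) w)
  have hpath : Tendsto (fun δ : ℝ => w + (δ:ℂ)) (𝓝[>] 0) (𝓝 w) := by
    have : ContinuousAt (fun δ : ℝ => w + (δ:ℂ)) 0 := by fun_prop
    have h := this.tendsto
    simp only [Complex.ofReal_zero, add_zero] at h
    exact h.mono_left nhdsWithin_le_nhds
  have h1 := hcont.tendsto.comp hpath
  have hd : w - 1 ≠ 0 := sub_ne_zero.2 hw1
  have h2 : Tendsto (fun z : ℂ => K / ‖z - 1‖) (𝓝 w) (𝓝 (K / ‖w - 1‖)) := by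
    apply Tendsto.div tendsto_const_nhds
    · exact ((continuous_id.sub continuous_const).norm.tendsto w)
    · exact norm_ne_zero_iff.2 hd
  refine le_of_tendsto_of_tendsto h1 (h2.comp hpath) ?_
  have h3 : ∀ᶠ z in 𝓝 w, z ≠ 1 ∧ ‖z‖ < ε * M :=
    (eventually_ne_nhds hw1).and (continuous_norm.continuousAt.eventually_lt continuousAt_const hwM)
  filter_upwards [hpath.eventually h3, self_mem_nhdsWithin] with δ hδ hp
  refine main _ M ?_ hδ.1 hM hδ.2
  have : (0:ℝ) < δ := hp
  simp; linarith

noncomputable def stF (z : ℂ) : ℂ :=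
  Complex.exp ((z - 1/2) * Complex.log z - z + 1/2 * (Real.log (2 * Real.pi) : ℝ))

noncomputable def stG (z : ℂ) : ℂ := (z + 1/2) * Complex.log (1 + 1/z) - 1

lemma log_mul_of_re_pos {x y : ℂ} (hx : 0 < x.re) (hy : 0 < y.re) :
    Complex.log (x * y) = Complex.log x + Complex.log y := by
  have hx0 : x ≠ 0 := by rintro rfl; simp at hx
  have hy0 : y ≠ 0 := by rintro rfl; simp at hy
  have h1 := abs_lt.1 (Complex.abs_arg_lt_pi_div_two_iff.2 (Or.inl hx))
  have h2 := abs_lt.1 (Complex.abs_arg_lt_pi_div_two_iff.2 (Or.inl hy))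
  exact Complex.log_mul hx0 hy0 ⟨by linarith, by linarith⟩

lemma re_one_add_inv {z : ℂ} (hz : 0 < z.re) : 0 < (1 + 1/z).re := by
  have hz0 : z ≠ 0 := by rintro rfl; simp at hz
  have : 0 < Complex.normSq z := Complex.normSq_pos.2 hz0
  simp only [Complex.add_re, Complex.one_re, one_div, Complex.inv_re]
  positivity

lemma stF_succ {z : ℂ} (hz : 0 < z.re) : stF (z + 1) = stF z * (z * Complex.exp (stG z)) := by
  have hz0 : z ≠ 0 := by rintro rfl; simp at hz
  have hl : Complex.log (z + 1) = Complex.log z + Complex.log (1 + 1/z) := by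
    rw [← log_mul_of_re_pos hz (re_one_add_inv hz)]
    congr 1; field_simp
  have h1 : z * Complex.exp (stG z) = Complex.exp (Complex.log z + stG z) := by
    rw [Complex.exp_add, Complex.exp_log hz0]
  rw [h1]
  unfold stF stG
  rw [← Complex.exp_add, hl]
  congr 1; ring

lemma stG_bound {z : ℂ} (hz : 2 ≤ ‖z‖) : ‖stG z‖ ≤ 2 / ‖z‖ ^ 2 := by
  have hzp : 0 < ‖z‖ := by linarith
  have hz0 : z ≠ 0 := norm_pos_iff.1 hzp
  have hx : ‖1/z‖ ≤ 1/2 := by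
    rw [norm_div, norm_one]; gcongr
  set x := 1/z with hxdef
  have h := Complex.norm_log_sub_logTaylor_le 2 (z := x) (by linarith)
  have hT : Complex.logTaylor (2+1) x = x - x^2/2 := by
    simp [Complex.logTaylor_succ, Complex.logTaylor_zero]; ring
  rw [hT] at h
  have h' : ‖Complex.log (1 + x) - (x - x^2/2)‖ ≤ 2/3 * ‖x‖^3 := by
    refine h.trans ?_
    have : (1 - ‖x‖)⁻¹ ≤ 2 := by
      rw [inv_le_comm₀ (by linarith) (by norm_num)]; linarith
    norm_num
    have h3 : 0 ≤ ‖x‖^3 := by positivity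
    nlinarith
  have hzx : z * x = 1 := by rw [hxdef]; field_simp
  have e : stG z = (z + 1/2) * (Complex.log (1+x) - (x - x^2/2)) - x^2/4 := by
    unfold stG; rw [← hxdef]
    linear_combination (1 - x/2) * hzx
  have hzn : ‖z‖ * ‖x‖ = 1 := by rw [← norm_mul, hzx, norm_one]
  rw [e]
  have n1 : ‖z + 1/2‖ ≤ ‖z‖ + 1/2 := by
    refine (norm_add_le _ _).trans ?_; norm_num
  have n2 : ‖x^2/4‖ = ‖x‖^2/4 := by rw [norm_div, norm_pow]; norm_num
  have n3 : 2 / ‖z‖^2 = 2 * ‖x‖^2 := by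
    rw [hxdef, norm_div, norm_one]; field_simp
  rw [n3]
  refine (norm_sub_le _ _).trans ?_
  rw [norm_mul, n2]
  have : ‖z + 1/2‖ * ‖Complex.log (1 + x) - (x - x^2/2)‖ ≤ (‖z‖ + 1/2) * (2/3 * ‖x‖^3) := by gcongr
  have e2 : (‖z‖ + 1/2) * (2/3 * ‖x‖^3) = 2/3 * ‖x‖^2 + 1/3 * ‖x‖ * ‖x‖^2 := by
    linear_combination (2/3 * ‖x‖^2) * hzn
  have : ‖x‖ * ‖x‖^2 ≤ 1/2 * ‖x‖^2 := by gcongr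
  have : 0 ≤ ‖x‖^2 := by positivity
  linarith

lemma stG_sum {z : ℂ} (hz : 0 < z.re) (ht : 2 ≤ |z.im|) (n : ℕ) :
    ‖∑ k ∈ Finset.range n, stG (z + k)‖ ≤ 8 / |z.im| := by
  set t := |z.im| with htd
  have b : ∀ k : ℕ, ‖stG (z + k)‖ ≤ 4 / (t + k)^2 := by
    intro k
    have hk : (0:ℝ) ≤ k := Nat.cast_nonneg k
    have hn : t ≤ ‖z + k‖ := by
      have := Complex.abs_im_le_norm (z + k)
      simpa using this
    have hs : ‖z + k‖^2 = (z.re + k)^2 + t^2 := by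
      rw [htd, sq_abs, ← Complex.normSq_eq_norm_sq, Complex.normSq_apply]
      simp; ring
    refine (stG_bound (ht.trans hn)).trans ?_
    rw [hs, div_le_div_iff₀ (by nlinarith) (by nlinarith)]
    nlinarith [sq_nonneg (t - k)]
  have key : ∀ n : ℕ, ∑ k ∈ Finset.range n, 4 / (t + k)^2 ≤ 4 / (t - 1) - 4 / (t + n - 1) := by
    intro n
    induction n with
    | zero => simp
    | succ n ih =>
      rw [Finset.sum_range_succ]
      have hk : (0:ℝ) ≤ n := Nat.cast_nonneg n
      have : 4 / (t + n)^2 ≤ 4 / (t + n - 1) - 4 / (t + ((n+1:ℕ):ℝ) - 1) := by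
        have h1 : 0 < t + n - 1 := by linarith
        have h2 : 0 < t + n := by linarith
        have : 4 / (t + n - 1) - 4 / (t + ((n+1:ℕ):ℝ) - 1) = 4 / ((t + n - 1) * (t+n)) := by
          push_cast
          rw [show t + ((n:ℝ) + 1) - 1 = t + n by ring]
          field_simp; ring
        rw [this]
        gcongr
        nlinarith
      linarith
  have hn : (0:ℝ) ≤ n := Nat.cast_nonneg n
  calc _ ≤ ∑ k ∈ Finset.range n, 4 / (t + k)^2 := norm_sum_le_of_le _ (fun k _ => b k)
    _ ≤ 4 / (t - 1) - 4 / (t + n - 1) := key n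
    _ ≤ 4 / (t - 1) := by
      have : 0 ≤ 4 / (t + n - 1) := by apply div_nonneg <;> linarith
      linarith
    _ ≤ 8 / t := by
      rw [div_le_div_iff₀ (by linarith) (by linarith)]; linarith

lemma Gamma_add_nat_eq {z : ℂ} (hz : 0 < z.re) (n : ℕ) :
    Complex.Gamma (z + n) = (∏ j ∈ Finset.range n, (z + j)) * Complex.Gamma z := by
  induction n with
  | zero => simp
  | succ n ih =>
    have : z + n ≠ 0 := by
      intro h
      have := congrArg Complex.re h
      simp at this
      have hn : (0:ℝ) ≤ n := Nat.cast_nonneg n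
      linarith
    rw [Finset.prod_range_succ, show z + ((n+1:ℕ):ℂ) = (z + n) + 1 by push_cast; ring,
      Complex.Gamma_add_one _ this, ih]
    ring

lemma stF_add_nat {z : ℂ} (hz : 0 < z.re) (n : ℕ) :
    stF (z + n) = stF z * ((∏ j ∈ Finset.range n, (z + j)) * Complex.exp (∑ k ∈ Finset.range n, stG (z + k))) := by
  induction n with
  | zero => simp
  | succ n ih =>
    have : 0 < (z + n).re := by
      have hn : (0:ℝ) ≤ n := Nat.cast_nonneg n
      simp; linarith
    rw [Finset.prod_range_succ, Finset.sum_range_succ, Complex.exp_add,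
      show z + ((n+1:ℕ):ℂ) = (z + n) + 1 by push_cast; ring, stF_succ this, ih]
    ring

lemma ratio_tendsto {z : ℂ} (hz : 0 < z.re) :
    Tendsto (fun n : ℕ => Complex.Gamma (z + (n+1:ℕ)) / stF (z + (n+1:ℕ))) atTop (𝓝 1) := by
  have hG0 := Complex.Gamma_ne_zero_of_re_pos hz
  have t1 : Tendsto (fun n => Complex.Gamma z / Complex.GammaSeq z n) atTop (𝓝 1) := by
    have := (tendsto_const_nhds (x := Complex.Gamma z)).div (Complex.GammaSeq_tendsto_Gamma z) hG0
    rwa [div_self hG0] at this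
  have hpi : (0:ℝ) < √Real.pi := by positivity
  have t2 : Tendsto (fun n => ((Stirling.stirlingSeq n / √Real.pi : ℝ) : ℂ)) atTop (𝓝 1) := by
    have := Stirling.tendsto_stirlingSeq_sqrt_pi.div_const (√Real.pi)
    rw [div_self hpi.ne'] at this
    exact (Complex.continuous_ofReal.tendsto 1).comp this |>.trans (by simp)
  let A : ℕ → ℂ := fun n => (z + 1) - (z + n + 1/2) * Complex.log (1 + (z+1)/n)
  have t3 : Tendsto (fun n => Complex.exp (A n)) atTop (𝓝 1) := by
    have hinv : Tendsto (fun n : ℕ => (z+1)/(n:ℂ)) atTop (𝓝 0) :=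
      tendsto_const_div_atTop_nhds_zero_nat (z+1)
    have l1 : Tendsto (fun n : ℕ => (n:ℂ) * Complex.log (1 + (z+1)/n)) atTop (𝓝 (z+1)) := by
      apply Complex.tendsto_nat_mul_log_one_add_of_tendsto
      refine tendsto_const_nhds.congr' ?_
      filter_upwards [eventually_gt_atTop 0] with n hn
      have : (n:ℂ) ≠ 0 := by exact_mod_cast hn.ne'
      field_simp
    have l2 : Tendsto (fun n : ℕ => Complex.log (1 + (z+1)/n)) atTop (𝓝 0) := by
      have : ContinuousAt (fun x : ℂ => Complex.log (1 + x)) 0 := by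
        apply ContinuousAt.clog (by fun_prop)
        simp
      have h := this.tendsto.comp hinv
      simpa [Function.comp_def] using h
    have l3 : Tendsto A atTop (𝓝 0) := by
      have := (tendsto_const_nhds (x := z + 1)).sub (l1.add (l2.const_mul (z + 1/2)))
      simp only [mul_zero, add_zero, sub_self] at this
      refine this.congr ?_
      intro n; simp only [A]; ring
    have := (Complex.continuous_exp.tendsto 0).comp l3
    simpa [Function.comp_def] using this
  have t := (t1.mul t2).mul t3
  simp only [mul_one] at t
  refine t.congr' ?_
  filter_upwards [eventually_gt_atTop 0] with n hn
  have hnr : (0:ℝ) < n := by exact_mod_cast hn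
  have hn0 : (n:ℂ) ≠ 0 := by exact_mod_cast hn.ne'
  have hzn : 0 < (z + (n+1:ℕ)).re := by simp; linarith
  have hlog : Complex.log (z + (n+1:ℕ)) = (Real.log n : ℝ) + Complex.log (1 + (z+1)/n) := by
    have h0 : 1 + (z+1)/n ≠ 0 := by
      intro h
      have : z + (n+1:ℕ) = n * (1 + (z+1)/n) := by push_cast; field_simp; ring
      rw [this, h] at hzn; simp at hzn
    rw [← Complex.log_ofReal_mul hnr h0]
    congr 1; push_cast; field_simp; ring
  have hprod : ∏ j ∈ Finset.range (n+1), (z + j) ≠ 0 := by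
    rw [Finset.prod_ne_zero_iff]
    intro j _ h
    have := congrArg Complex.re h
    simp at this
    have hn : (0:ℝ) ≤ j := Nat.cast_nonneg j
    linarith
  have hcp : (n:ℂ)^z ≠ 0 := by
    rw [Complex.cpow_def_of_ne_zero hn0]; exact Complex.exp_ne_zero _
  have hfac : (n.factorial : ℂ) ≠ 0 := by exact_mod_cast n.factorial_ne_zero
  have hfac' : (n.factorial : ℝ) = Stirling.stirlingSeq n / √Real.pi *
      Real.exp (1/2 * Real.log (2 * Real.pi) + 1/2 * Real.log n + n * Real.log n - n) := by
    have e1 : Real.exp (1/2 * Real.log (2 * Real.pi) + 1/2 * Real.log n + n * Real.log n - n)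
        = √Real.pi * (√(2 * n) * (n / Real.exp 1)^n) := by
      have a1 : Real.exp (1/2 * Real.log (2 * Real.pi) + 1/2 * Real.log n) = √Real.pi * √(2*n) := by
        rw [← mul_add, ← Real.log_mul (by positivity) hnr.ne', ← Real.sqrt_mul (by positivity),
          mul_comm, ← Real.rpow_def_of_pos (by positivity), ← Real.sqrt_eq_rpow]
        congr 1; ring
      have a2 : Real.exp (n * Real.log n - n) = (n / Real.exp 1)^n := by
        rw [div_pow, ← Real.exp_nat_mul, Real.exp_sub, mul_one, Real.exp_nat_mul, Real.exp_log hnr]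
      rw [show 1/2 * Real.log (2 * Real.pi) + 1/2 * Real.log n + n * Real.log n - n = 
        (1/2 * Real.log (2 * Real.pi) + 1/2 * Real.log n) + (n * Real.log n - n) by ring,
        Real.exp_add, a1, a2]; ring
    rw [e1]; unfold Stirling.stirlingSeq
    have : √(2 * (n:ℝ)) ≠ 0 := by positivity
    have : (n / Real.exp 1)^n ≠ 0 := by positivity
    field_simp
  have hfc : (n.factorial : ℂ) = ((Stirling.stirlingSeq n / √Real.pi : ℝ) : ℂ) * 
      Complex.exp (1/2 * (Real.log (2 * Real.pi) : ℝ) + 1/2 * (Real.log n : ℝ) + n * (Real.log n : ℝ) - n) := by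
    have := congrArg (fun x : ℝ => (x:ℂ)) hfac'
    push_cast at this ⊢
    exact this
  have hexp : (n:ℂ)^z * Complex.exp (1/2 * (Real.log (2 * Real.pi) : ℝ) + 1/2 * (Real.log n : ℝ) + n * (Real.log n : ℝ) - n)
      = Complex.exp (A n) * stF (z + (n+1:ℕ)) := by
    unfold stF
    rw [hlog, Complex.cpow_def_of_ne_zero hn0, ← Complex.exp_add, ← Complex.exp_add,
      ← Complex.natCast_log]
    congr 1
    simp only [A]; push_cast; ring
  have hF : stF (z + (n+1:ℕ)) ≠ 0 := Complex.exp_ne_zero _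
  rw [Gamma_add_nat_eq hz, eq_div_iff hF]
  unfold Complex.GammaSeq
  rw [mul_assoc, ← hexp, mul_assoc, mul_left_comm _ ((n:ℂ)^z), ← hfc]
  field_simp

lemma stirling {z : ℂ} (hz : 0 < z.re) (ht : 8 ≤ |z.im|) :
    ‖Complex.Gamma z / stF z - 1‖ ≤ 16 / |z.im| := by
  have hF : stF z ≠ 0 := Complex.exp_ne_zero _
  let E : ℕ → ℂ := fun n => ∑ k ∈ Finset.range n, stG (z + k)
  let ρ : ℕ → ℂ := fun n => Complex.Gamma (z + (n+1:ℕ)) / stF (z + (n+1:ℕ))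
  have hρ : Tendsto ρ atTop (𝓝 1) := ratio_tendsto hz
  have hE : ∀ n, ‖E n‖ ≤ 8 / |z.im| := fun n => stG_sum hz (by linarith) n
  have hE1 : ∀ n, ‖E n‖ ≤ 1 := fun n => (hE n).trans (by rw [div_le_one (by linarith)]; exact ht)
  have hexp : ∀ n, ‖Complex.exp (E n) - 1‖ ≤ 16 / |z.im| := fun n =>
    (Complex.norm_exp_sub_one_le (hE1 n)).trans (by
      have := hE n
      calc 2 * ‖E n‖ ≤ 2 * (8 / |z.im|) := by gcongr
        _ = _ := by ring)
  have hexp3 : ∀ n, ‖Complex.exp (E n)‖ ≤ 3 := fun n => by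
    have h1 := Complex.norm_exp_sub_one_le (hE1 n)
    have h2 : ‖Complex.exp (E n)‖ ≤ ‖Complex.exp (E n) - 1‖ + ‖(1:ℂ)‖ := by
      simpa using norm_add_le (Complex.exp (E n) - 1) 1
    rw [norm_one] at h2
    linarith [hE1 n]
  have eq : ∀ n, Complex.Gamma z / stF z = Complex.exp (E (n+1)) * ρ n := by
    intro n
    simp only [ρ]
    rw [Gamma_add_nat_eq hz, stF_add_nat hz]
    have hprod : ∏ j ∈ Finset.range (n+1), (z + j) ≠ 0 := by
      rw [Finset.prod_ne_zero_iff]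
      intro j _ h
      have := congrArg Complex.re h
      simp at this
      have hn : (0:ℝ) ≤ j := Nat.cast_nonneg j
      linarith
    have he := Complex.exp_ne_zero (E (n+1))
    simp only [E] at he ⊢
    field_simp
  have lim : Tendsto (fun n => 3 * ‖ρ n - 1‖ + 16 / |z.im|) atTop (𝓝 (16 / |z.im|)) := by
    have := ((hρ.sub_const 1).norm.const_mul 3).add_const (16 / |z.im|)
    simpa using this
  refine ge_of_tendsto' lim (fun n => ?_)
  rw [eq n, show Complex.exp (E (n+1)) * ρ n - 1 = Complex.exp (E (n+1)) * (ρ n - 1) + (Complex.exp (E (n+1)) - 1) by ring]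
  refine (norm_add_le _ _).trans ?_
  rw [norm_mul]
  gcongr
  · exact hexp3 _
  · exact hexp _

noncomputable def chiF (w : ℂ) : ℂ :=
  2 * (2 * (Real.pi:ℂ)) ^ (-w) * Complex.Gamma w * Complex.cos ((Real.pi:ℂ) * w / 2)

noncomputable def chiX (a t : ℝ) : ℂ :=
  Complex.exp (((a:ℂ) - Complex.I * t - 1/2) * ((Real.log t - Real.log (2 * Real.pi) : ℝ) : ℂ)
    + Complex.I * Real.pi / 4 + Complex.I * t)

lemma log_aux (a t : ℝ) (ht : 0 < t) :
    Complex.log ((a:ℂ) - Complex.I * t) =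
      (Real.log t : ℝ) - Complex.I * Real.pi / 2 + Complex.log (1 + Complex.I * a / t) := by
  have htc : (t:ℂ) ≠ 0 := by exact_mod_cast ht.ne'
  have hre : 0 < (1 + Complex.I * a / t).re := by
    rw [show Complex.I * a / t = ((a/t : ℝ) : ℂ) * Complex.I by push_cast; ring]
    simp
  have hy0 : 1 + Complex.I * a / t ≠ 0 := by intro h; rw [h] at hre; simp at hre
  have e : (a:ℂ) - Complex.I * t = (t:ℂ) * (-Complex.I * (1 + Complex.I * a / t)) := by
    field_simp
    linear_combination (a : ℂ) * Complex.I_sq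
  have h2 := abs_lt.1 (Complex.abs_arg_lt_pi_div_two_iff.2 (Or.inl hre))
  have hpi := Real.pi_pos
  rw [e, Complex.log_ofReal_mul ht (mul_ne_zero (by simp) hy0), Complex.log_mul (by simp) hy0
    (by rw [Complex.arg_neg_I]; exact ⟨by linarith, by linarith⟩), Complex.log_neg_I]
  ring

lemma chi_approx (a : ℝ) (ha : 1 ≤ a) : ∃ T K : ℝ, 0 < T ∧ 0 < K ∧ ∀ t : ℝ, T ≤ t →
    ‖chiF ((a:ℂ) - Complex.I * t) / chiX a t - 1‖ ≤ K / t := by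
  let B : ℝ := a^2 + (a + 1 + 1) * a^2
  refine ⟨16 + 2 * a + B, 99 + 2 * B, by positivity, by positivity, ?_⟩
  intro t hT
  have hB : 0 ≤ B := by positivity
  have ht : 0 < t := by linarith
  have htc : (t:ℂ) ≠ 0 := by exact_mod_cast ht.ne'
  set w : ℂ := (a:ℂ) - Complex.I * t with hw
  have hre : w.re = a := by simp [hw]
  have him : w.im = -t := by simp [hw]
  set ℓ := Complex.log (1 + Complex.I * a / t) with hℓ
  set η : ℂ := (w - 1/2) * ℓ - a with hη
  set P := Complex.Gamma w / stF w
  set Q := 1 + Complex.exp (-(Complex.I * Real.pi * w)) with hQ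
  set R := Complex.exp η
  have hpi := Real.pi_pos
  have hF : stF w ≠ 0 := Complex.exp_ne_zero _
  have hX : chiX a t ≠ 0 := Complex.exp_ne_zero _
  have fac : chiF w / chiX a t = P * Q * R := by
    rw [div_eq_iff hX]
    have h2pi : (2 * (Real.pi:ℂ)) ≠ 0 := by
      exact_mod_cast (by positivity : (2 * Real.pi) ≠ 0)
    have c1 : 2 * Complex.cos ((Real.pi:ℂ) * w / 2) = Complex.exp (Complex.I * Real.pi * w / 2) * Q := by
      rw [Complex.two_cos, hQ, mul_add, mul_one, ← Complex.exp_add]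
      congr 2 <;> ring
    have c2 : (2 * (Real.pi:ℂ)) ^ (-w) = Complex.exp (-(w * (Real.log (2 * Real.pi) : ℝ))) := by
      rw [Complex.cpow_def_of_ne_zero h2pi, Complex.ofReal_log (by positivity)]
      congr 1; push_cast; ring
    have c3 : Complex.exp (-(w * (Real.log (2 * Real.pi) : ℝ))) * stF w * Complex.exp (Complex.I * Real.pi * w / 2)
        = R * chiX a t := by
      unfold stF chiX
      rw [hw, log_aux a t ht, ← hw, ← hℓ, ← Complex.exp_add, ← Complex.exp_add, ← Complex.exp_add]
      congr 1
      rw [hη, hw]; push_cast; ring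
    have c4 : Complex.Gamma w = P * stF w := by simp only [P]; field_simp
    unfold chiF
    rw [c4, c2]
    linear_combination (Complex.exp (-(w * (Real.log (2 * Real.pi) : ℝ))) * (P * stF w)) * c1 + P * Q * c3
  have hP : ‖P - 1‖ ≤ 16 / t := by
    have := stirling (z := w) (by rw [hre]; linarith) (by rw [him, abs_neg, abs_of_pos ht]; linarith)
    rwa [him, abs_neg, abs_of_pos ht] at this
  have hQ1 : ‖Q - 1‖ ≤ 1 / t := by
    rw [hQ, add_sub_cancel_left, Complex.norm_exp]
    have : (-(Complex.I * Real.pi * w)).re = -(Real.pi * t) := by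
      simp [hw]
    rw [this, Real.exp_neg, ← one_div]
    have h1 := Real.add_one_le_exp (Real.pi * t)
    have : t ≤ Real.pi * t := by nlinarith [Real.pi_gt_three]
    gcongr
    linarith
  have hη1 : ‖η‖ ≤ B / t := by
    set x := Complex.I * (a:ℂ) / t with hx
    have hxn : ‖x‖ = a / t := by
      rw [hx, norm_div, norm_mul, Complex.norm_I, Complex.norm_real, Complex.norm_real,
        Real.norm_of_nonneg (by linarith), Real.norm_of_nonneg ht.le, one_mul]
    have hx2 : ‖x‖ ≤ 1/2 := by
      rw [hxn, div_le_div_iff₀ ht (by norm_num)]; linarith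
    have hl : ‖ℓ - x‖ ≤ (a/t)^2 := by
      refine (Complex.norm_log_one_add_sub_self_le (by linarith)).trans ?_
      have : (1 - ‖x‖)⁻¹ ≤ 2 := by
        rw [inv_le_comm₀ (by linarith) (by norm_num)]; linarith
      rw [← hxn]
      nlinarith [sq_nonneg ‖x‖]
    have e : η = (w - 1/2) * (ℓ - x) + ((a - 1/2 : ℝ) : ℂ) * x := by
      rw [hη, hw, hx]; push_cast; field_simp
      linear_combination (-2 * a * t:ℂ) * Complex.I_sq
    have hw2 : ‖w - 1/2‖ ≤ a + 1 + t := by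
      have : ‖w‖ ≤ a + t := by
        rw [hw]; refine (norm_sub_le _ _).trans ?_
        rw [norm_mul, Complex.norm_I, Complex.norm_real, Complex.norm_real,
        Real.norm_of_nonneg (by linarith), Real.norm_of_nonneg ht.le, one_mul]
      refine (norm_sub_le _ _).trans ?_
      have : ‖(1/2:ℂ)‖ = 1/2 := by norm_num
      linarith
    rw [e]
    refine (norm_add_le _ _).trans ?_
    rw [norm_mul, norm_mul, Complex.norm_real, Real.norm_of_nonneg (by linarith), hxn]
    have ht1 : 1 ≤ t := by linarith
    calc _ ≤ (a + 1 + t) * (a/t)^2 + a * (a/t) := by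
          gcongr; linarith
      _ ≤ ((a + 1)*t + t) * (a/t)^2 + a * (a/t) := by
          gcongr; nlinarith
      _ = B / t := by simp only [B]; field_simp; ring
  have hη2 : ‖η‖ ≤ 1 := hη1.trans (by rw [div_le_one ht]; linarith)
  have hR : ‖R - 1‖ ≤ 2 * (B / t) := (Complex.norm_exp_sub_one_le hη2).trans (by gcongr)
  have hR3 : ‖R‖ ≤ 3 := by
    have h1 := Complex.norm_exp_sub_one_le hη2
    have h2 : ‖R‖ ≤ ‖R - 1‖ + ‖(1:ℂ)‖ := by
      simpa using norm_add_le (R - 1) 1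
    rw [norm_one] at h2
    linarith
  have hQ2 : ‖Q‖ ≤ 2 := by
    have h2 : ‖Q‖ ≤ ‖Q - 1‖ + ‖(1:ℂ)‖ := by
      simpa using norm_add_le (Q - 1) 1
    rw [norm_one] at h2
    have : 1 / t ≤ 1 := by rw [div_le_one ht]; linarith
    linarith
  rw [fac, show P * Q * R - 1 = (P - 1) * Q * R + (Q - 1) * R + (R - 1) by ring]
  calc _ ≤ ‖P - 1‖ * ‖Q‖ * ‖R‖ + ‖Q - 1‖ * ‖R‖ + ‖R - 1‖ := by
        refine (norm_add_le _ _).trans ?_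
        gcongr
        refine (norm_add_le _ _).trans ?_
        rw [norm_mul, norm_mul, norm_mul]
    _ ≤ 16 / t * 2 * 3 + 1 / t * 3 + 2 * (B / t) := by gcongr
    _ = _ := by ring

lemma chi_seq (a d : ℝ) (ha : 1 ≤ a) (hd : 0 < d) : ∃ K : ℝ, 0 < K ∧ ∀ n : ℕ, 1 ≤ n →
    ‖chiF ((a:ℂ) - Complex.I * ((2 * Real.pi * d * n : ℝ) : ℂ)) / chiX a (2 * Real.pi * d * n) - 1‖ ≤ K / n := by
  obtain ⟨T, K, hT, hK, H⟩ := chi_approx a ha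
  have hp : 0 < 2 * Real.pi * d := by positivity
  have : (fun n : ℕ => chiF ((a:ℂ) - Complex.I * ((2 * Real.pi * d * n : ℝ) : ℂ)) / chiX a (2 * Real.pi * d * n) - 1)
      =O[atTop] (fun n : ℕ => 1 / (n:ℝ)) := by
    rw [Asymptotics.isBigO_iff]
    refine ⟨K / (2 * Real.pi * d), ?_⟩
    have h1 : Tendsto (fun n : ℕ => 2 * Real.pi * d * (n:ℝ)) atTop atTop :=
      tendsto_natCast_atTop_atTop.const_mul_atTop hp
    filter_upwards [h1.eventually_ge_atTop T] with n hn
    refine (H _ hn).trans ?_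
    rw [Real.norm_of_nonneg (by positivity)]
    apply le_of_eq
    rw [div_mul_div_comm, mul_one]
  obtain ⟨C, hC, h⟩ := Asymptotics.bound_of_isBigO_nat_atTop this
  refine ⟨C, hC, fun n hn => ?_⟩
  have hn0 : (0:ℝ) < n := by exact_mod_cast hn
  have := h (x := n) (by positivity)
  rwa [Real.norm_of_nonneg (by positivity), mul_one_div] at this

lemma zeta_seq (a d : ℝ) (ha : 1 ≤ a) (hd : 0 < d) : ∃ C K : ℝ, 1 < C ∧ 0 < K ∧ ∀ n M : ℕ, 1 ≤ n → C * n ≤ M →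
    ‖riemannZeta ((a:ℂ) - Complex.I * ((2 * Real.pi * d * n : ℝ) : ℂ))
      - ∑ m ∈ Finset.Icc 1 M, (m:ℂ) ^ (-((a:ℂ) - Complex.I * ((2 * Real.pi * d * n : ℝ) : ℂ)))‖ ≤ K / n := by
  obtain ⟨ε, K, hε, hK, H⟩ := zeta_approx
  have hp : 0 < 2 * Real.pi * d := by positivity
  have hC : 0 < (a + 2 * Real.pi * d) / ε := by positivity
  refine ⟨(a + 2 * Real.pi * d) / ε + 2, K / (2 * Real.pi * d), by linarith, by positivity, ?_⟩
  intro n M hn hM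
  have hn1 : (1:ℝ) ≤ n := by exact_mod_cast hn
  set t : ℝ := 2 * Real.pi * d * n with ht
  have htp : 0 < t := by positivity
  have him : ((a:ℂ) - Complex.I * (t:ℂ) - 1).im = -t := by simp
  have hn2 : t ≤ ‖(a:ℂ) - Complex.I * (t:ℂ) - 1‖ := by
    have := Complex.abs_im_le_norm ((a:ℂ) - Complex.I * (t:ℂ) - 1)
    rwa [him, abs_neg, abs_of_pos htp] at this
  have h := H ((a:ℂ) - Complex.I * (t:ℂ)) (M+1) (by simpa using ha)
    (by intro h; rw [h] at hn2; simp at hn2; linarith) (by omega) (by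
      have h1 : ‖(a:ℂ) - Complex.I * (t:ℂ)‖ ≤ a + t := by
        refine (norm_sub_le _ _).trans ?_
        rw [norm_mul, Complex.norm_I, Complex.norm_real, Complex.norm_real,
          Real.norm_of_nonneg (by linarith), Real.norm_of_nonneg htp.le, one_mul]
      have h2 : a + t ≤ (a + 2 * Real.pi * d) * n := by rw [ht]; nlinarith
      have h3 : (a + 2 * Real.pi * d) / ε * n ≤ M := by nlinarith
      have h4 : (a + 2 * Real.pi * d) * n ≤ ε * M := by
        have := mul_le_mul_of_nonneg_left h3 hε.le
        calc _ = ε * ((a + 2 * Real.pi * d) / ε * n) := by field_simp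
          _ ≤ _ := this
      push_cast
      linarith)
  have hI : Finset.Ico 1 (M+1) = Finset.Icc 1 M := by ext; simp
  rw [hI] at h
  refine h.trans ?_
  rw [div_div, ← ht]
  gcongr

lemma sum_bound (a d : ℝ) (ha : 1 ≤ a) (C K : ℝ) (hC : 1 < C) (hK : 0 < K)
    (H : ∀ n M : ℕ, 1 ≤ n → C * n ≤ M →
    ‖riemannZeta ((a:ℂ) - Complex.I * ((2 * Real.pi * d * n : ℝ) : ℂ))
      - ∑ m ∈ Finset.Icc 1 M, (m:ℂ) ^ (-((a:ℂ) - Complex.I * ((2 * Real.pi * d * n : ℝ) : ℂ)))‖ ≤ K / n) :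
    ∃ K' : ℝ, 0 < K' ∧ ∀ n M : ℕ, 1 ≤ n → C * n ≤ M →
    ‖∑ m ∈ Finset.Icc 1 M, (m:ℂ) ^ (-((a:ℂ) - Complex.I * ((2 * Real.pi * d * n : ℝ) : ℂ)))‖
      ≤ K' * (n:ℝ) ^ (1/4:ℝ) := by
  refine ⟨2 * K + 1 + 4 * (C+1)^(1/4:ℝ), by positivity, ?_⟩
  intro n M hn hM
  have hn1 : (1:ℝ) ≤ n := by exact_mod_cast hn
  have hnq : 1 ≤ (n:ℝ) ^ (1/4:ℝ) := Real.one_le_rpow hn1 (by norm_num)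
  set w : ℂ := (a:ℂ) - Complex.I * ((2 * Real.pi * d * n : ℝ) : ℂ) with hw
  have hre : w.re = a := by simp [hw]
  set M0 : ℕ := ⌈C * n⌉₊ with hM0
  have hM0' : C * n ≤ M0 := Nat.le_ceil _
  have hM1 : (M0:ℝ) ≤ (C+1) * n := by
    have := (Nat.ceil_lt_add_one (a := C * n) (by positivity)).le
    rw [← hM0] at this
    nlinarith
  have hM0p : (1:ℝ) ≤ M0 := by nlinarith
  have h1 := H n M hn hM
  have h2 := H n M0 hn hM0'
  have h3 : ‖∑ m ∈ Finset.Icc 1 M0, (m:ℂ) ^ (-w)‖ ≤ 1 + Real.log M0 := by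
    have hh := harmonic_le_one_add_log M0
    refine le_trans ?_ hh
    rw [harmonic_eq_sum_Icc]
    push_cast
    apply norm_sum_le_of_le
    intro m hm
    have hm := (Finset.mem_Icc.1 hm).1
    have hm1 : (1:ℝ) ≤ m := by exact_mod_cast hm
    rw [Complex.norm_natCast_cpow_of_pos hm, ← Real.rpow_neg_one]
    apply Real.rpow_le_rpow_of_exponent_le hm1
    rw [Complex.neg_re, hre]; linarith
  have h4 : Real.log M0 ≤ 4 * (C+1)^(1/4:ℝ) * (n:ℝ)^(1/4:ℝ) := by
    have := Real.log_le_rpow_div (x := M0) (by positivity) (ε := 1/4) (by norm_num)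
    refine this.trans ?_
    rw [mul_assoc, ← Real.mul_rpow (by positivity) (by positivity)]
    have : (M0:ℝ)^(1/4:ℝ) ≤ ((C+1)*n)^(1/4:ℝ) := by gcongr
    linarith
  have h5 : K / n ≤ K := div_le_self hK.le hn1
  set S := ∑ m ∈ Finset.Icc 1 M, (m:ℂ) ^ (-w)
  set S0 := ∑ m ∈ Finset.Icc 1 M0, (m:ℂ) ^ (-w)
  have h6 : ‖S‖ ≤ ‖riemannZeta w - S‖ + ‖riemannZeta w - S0‖ + ‖S0‖ := by
    have : S = -(riemannZeta w - S) + (riemannZeta w - S0) + S0 := by ring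
    calc ‖S‖ = ‖-(riemannZeta w - S) + (riemannZeta w - S0) + S0‖ := by rw [← this]
      _ ≤ _ := by
        refine (norm_add_le _ _).trans ?_
        gcongr
        refine (norm_add_le _ _).trans ?_
        rw [norm_neg]
  have : (2 * K + 1) ≤ (2 * K + 1) * (n:ℝ) ^ (1/4:ℝ) := le_mul_of_one_le_right (by positivity) hnq
  nlinarith

lemma term_eq (σ d θ : ℝ) (hd : 0 < d) (m n : ℕ) (hm : 1 ≤ m) (hn : 1 ≤ n) :
    (Complex.exp (2 * (Real.pi : ℂ) * Complex.I / 8) *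
                (((d ^ ((1 : ℝ) / 2 - σ) : ℝ)) : ℂ)) * ((1 / ((((m : ℝ) ^ (1 - σ) : ℝ)) : ℂ)) *
       (Complex.exp (2 * (Real.pi : ℂ) * Complex.I * ((Fm d θ m n : ℝ) : ℂ)) /
                    ((Real.sqrt n : ℝ) : ℂ)))
    = Complex.exp (2 * (Real.pi : ℂ) * Complex.I * (θ : ℂ) * (n : ℂ)) / ((((n : ℝ) ^ (1 - σ) : ℝ)) : ℂ) *
      (chiX (1 - σ) (2 * Real.pi * d * n) *
        (m:ℂ) ^ (-(((1 - σ : ℝ):ℂ) - Complex.I * ((2 * Real.pi * d * n : ℝ) : ℂ)))) := by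
  have hm0 : (0:ℝ) < m := by exact_mod_cast hm
  have hn0 : (0:ℝ) < n := by exact_mod_cast hn
  have hmc : (m:ℂ) ≠ 0 := by exact_mod_cast hm0.ne'
  have hpi := Real.pi_pos
  have l1 : Real.log (2 * Real.pi * d * n) - Real.log (2 * Real.pi) = Real.log d + Real.log n := by
    rw [Real.log_mul (by positivity) hn0.ne', Real.log_mul (by positivity) hd.ne']; ring
  have l2 : Real.log (Real.exp 1 * m / (d * n)) = 1 + Real.log m - (Real.log d + Real.log n) := by
    rw [Real.log_div (by positivity) (by positivity), Real.log_mul (by positivity) hm0.ne',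
      Real.log_mul hd.ne' hn0.ne', Real.log_exp]
  unfold chiX Fm
  rw [l1, l2, Real.sqrt_eq_rpow, Real.rpow_def_of_pos hd, Real.rpow_def_of_pos hm0, Real.rpow_def_of_pos hn0,
    Real.rpow_def_of_pos hn0, Complex.cpow_def_of_ne_zero hmc, ← Complex.natCast_log]
  simp only [Complex.ofReal_exp]
  simp only [div_eq_mul_inv, one_mul, ← Complex.exp_neg, ← Complex.exp_add]
  congr 1
  push_cast
  ring

lemma norm_chiX (a d : ℝ) (hd : 0 < d) (n : ℕ) (hn : 1 ≤ n) :
    ‖chiX a (2 * Real.pi * d * n)‖ = d ^ (a - 1/2) * (n:ℝ) ^ (a - 1/2) := by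
  have hn0 : (0:ℝ) < n := by exact_mod_cast hn
  have l1 : Real.log (2 * Real.pi * d * n) - Real.log (2 * Real.pi) = Real.log d + Real.log n := by
    rw [Real.log_mul (by positivity) hn0.ne', Real.log_mul (by positivity) hd.ne']; ring
  unfold chiX
  rw [l1, Complex.norm_exp, Real.rpow_def_of_pos hd, Real.rpow_def_of_pos hn0, ← Real.exp_add]
  congr 1
  have : ((a:ℂ) - Complex.I * ((2 * Real.pi * d * n : ℝ):ℂ) - 1/2) * ((Real.log d + Real.log n : ℝ) : ℂ)
    + Complex.I * Real.pi / 4 + Complex.I * ((2 * Real.pi * d * n : ℝ):ℂ)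
    = (((a - 1/2) * (Real.log d + Real.log n) : ℝ) : ℂ) +
      ((-(2 * Real.pi * d * n) * (Real.log d + Real.log n) + Real.pi / 4 + 2 * Real.pi * d * n : ℝ) : ℂ) * Complex.I := by
    push_cast; ring
  rw [this, Complex.add_re, Complex.ofReal_re, Complex.re_ofReal_mul, Complex.I_re]
  ring

theorem statement7 (σ d θ : ℝ) (hσ : σ ≤ 0) (hd : 0 < d) :
    ∃ C : ℝ, 1 < C ∧ ∃ K > (0 : ℝ), ∀ M N : ℕ, 0 < M → 0 < N → C * N ≤ M →
      ‖(∑ n ∈ Finset.Icc 1 N,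
            riemannZeta ((σ : ℂ) + 2 * (Real.pi : ℂ) * Complex.I * (d : ℂ) * (n : ℂ)) *
              Complex.exp (2 * (Real.pi : ℂ) * Complex.I * (θ : ℂ) * (n : ℂ)) /
                ((((n : ℝ) ^ (1 - σ) : ℝ)) : ℂ))
          - (Complex.exp (2 * (Real.pi : ℂ) * Complex.I / 8) *
                (((d ^ ((1 : ℝ) / 2 - σ) : ℝ)) : ℂ)) *
              ∑ m ∈ Finset.Icc 1 M, (1 / ((((m : ℝ) ^ (1 - σ) : ℝ)) : ℂ)) *
                ∑ n ∈ Finset.Icc 1 N,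
                  Complex.exp (2 * (Real.pi : ℂ) * Complex.I * ((Fm d θ m n : ℝ) : ℂ)) /
                    ((Real.sqrt n : ℝ) : ℂ)‖ ≤ K := by
  have ha : 1 ≤ 1 - σ := by linarith
  obtain ⟨K1, hK1, H1⟩ := chi_seq (1-σ) d ha hd
  obtain ⟨C, K2, hC, hK2, H2⟩ := zeta_seq (1-σ) d ha hd
  obtain ⟨K3, hK3, H3⟩ := sum_bound (1-σ) d ha C K2 hC hK2 H2
  set B : ℝ := d ^ ((1 - σ) - 1/2) * ((1 + K1) * K2 + K1 * K3) with hB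
  have hBp : 0 < B := by positivity
  have hsm : Summable (fun n : ℕ => 1 / (n:ℝ) ^ (5/4:ℝ)) := Real.summable_one_div_nat_rpow.2 (by norm_num)
  have hts : 0 ≤ ∑' n : ℕ, 1 / (n:ℝ) ^ (5/4:ℝ) := tsum_nonneg (fun n => by positivity)
  refine ⟨C, hC, B * (∑' n : ℕ, 1 / (n:ℝ) ^ (5/4:ℝ)) + 1, by positivity, ?_⟩
  intro M N hM hN hMN
  let w : ℕ → ℂ := fun n => ((1 - σ : ℝ):ℂ) - Complex.I * ((2 * Real.pi * d * n : ℝ) : ℂ)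
  let S : ℕ → ℂ := fun n => ∑ m ∈ Finset.Icc 1 M, (m:ℂ) ^ (-(w n))
  let c : ℕ → ℂ := fun n => Complex.exp (2 * (Real.pi : ℂ) * Complex.I * (θ : ℂ) * (n : ℂ)) / ((((n : ℝ) ^ (1 - σ) : ℝ)) : ℂ)
  let X : ℕ → ℂ := fun n => chiX (1 - σ) (2 * Real.pi * d * n)
  have e1 : (Complex.exp (2 * (Real.pi : ℂ) * Complex.I / 8) *
                (((d ^ ((1 : ℝ) / 2 - σ) : ℝ)) : ℂ)) *
              ∑ m ∈ Finset.Icc 1 M, (1 / ((((m : ℝ) ^ (1 - σ) : ℝ)) : ℂ)) *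
                ∑ n ∈ Finset.Icc 1 N,
                  Complex.exp (2 * (Real.pi : ℂ) * Complex.I * ((Fm d θ m n : ℝ) : ℂ)) /
                    ((Real.sqrt n : ℝ) : ℂ) = ∑ n ∈ Finset.Icc 1 N, c n * (X n * S n) := by
    simp only [Finset.mul_sum, S]
    rw [Finset.sum_comm]
    refine Finset.sum_congr rfl fun n hn => Finset.sum_congr rfl fun m hm => ?_
    exact term_eq σ d θ hd m n (Finset.mem_Icc.1 hm).1 (Finset.mem_Icc.1 hn).1
  have e2 : ∀ n ∈ Finset.Icc 1 N, riemannZeta ((σ : ℂ) + 2 * (Real.pi : ℂ) * Complex.I * (d : ℂ) * (n : ℂ)) *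
              Complex.exp (2 * (Real.pi : ℂ) * Complex.I * (θ : ℂ) * (n : ℂ)) /
                ((((n : ℝ) ^ (1 - σ) : ℝ)) : ℂ) = c n * (chiF (w n) * riemannZeta (w n)) := by
    intro n hn
    have hn0 : (0:ℝ) < n := by exact_mod_cast (Finset.mem_Icc.1 hn).1
    have hw : (σ : ℂ) + 2 * (Real.pi : ℂ) * Complex.I * (d : ℂ) * (n : ℂ) = 1 - w n := by
      simp only [w]; push_cast; ring
    have hre : (w n).re = 1 - σ := by simp [w]
    have him : (w n).im = -(2 * Real.pi * d * n) := by simp [w]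
    have hz := riemannZeta_one_sub (s := w n) (by
      intro k h
      rw [h] at hre
      simp at hre
      have : (0:ℝ) ≤ k := Nat.cast_nonneg k
      linarith) (by
      intro h
      rw [h] at him
      have : 0 < 2 * Real.pi * d * n := by positivity
      simp at him
      rcases him with h | h
      · linarith
      · rw [h] at hn0; simp at hn0)
    rw [hw, hz]
    simp only [c, chiF]
    ring
  rw [e1, Finset.sum_congr rfl e2, ← Finset.sum_sub_distrib]
  have tb : ∀ n ∈ Finset.Icc 1 N, ‖c n * (chiF (w n) * riemannZeta (w n)) - c n * (X n * S n)‖ ≤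
      B * (1 / (n:ℝ) ^ (5/4:ℝ)) := by
    intro n hn
    obtain ⟨hn1, hnN⟩ := Finset.mem_Icc.1 hn
    have hn0 : (0:ℝ) < n := by exact_mod_cast hn1
    have hn1' : (1:ℝ) ≤ n := by exact_mod_cast hn1
    have hCM : C * n ≤ M := by
      refine le_trans ?_ hMN
      have : (n:ℝ) ≤ N := by exact_mod_cast hnN
      gcongr
    have h1 := H1 n hn1
    have h2 := H2 n M hn1 hCM
    have h3 := H3 n M hn1 hCM
    change ‖chiF (w n) / X n - 1‖ ≤ _ at h1
    change ‖riemannZeta (w n) - S n‖ ≤ _ at h2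
    change ‖S n‖ ≤ _ at h3
    have hX : X n ≠ 0 := Complex.exp_ne_zero _
    have hXn : ‖X n‖ = d ^ ((1 - σ) - 1/2) * (n:ℝ) ^ ((1 - σ) - 1/2) := norm_chiX (1-σ) d hd n hn1
    have hcn : ‖c n‖ = ((n:ℝ) ^ (1 - σ))⁻¹ := by
      simp only [c]
      rw [norm_div, Complex.norm_real, Real.norm_of_nonneg (by positivity),
        show 2 * (Real.pi : ℂ) * Complex.I * (θ : ℂ) * (n : ℂ) = ((2 * Real.pi * θ * n : ℝ) : ℂ) * Complex.I by
          push_cast; ring, Complex.norm_exp_ofReal_mul_I, one_div]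
    have eq : c n * (chiF (w n) * riemannZeta (w n)) - c n * (X n * S n) =
        c n * X n * ((chiF (w n) / X n) * (riemannZeta (w n) - S n) + (chiF (w n) / X n - 1) * S n) := by
      field_simp; ring
    have hq : ‖chiF (w n) / X n‖ ≤ 1 + K1 := by
      have : ‖chiF (w n) / X n‖ ≤ ‖chiF (w n) / X n - 1‖ + ‖(1:ℂ)‖ := by
        simpa using norm_add_le (chiF (w n) / X n - 1) 1
      rw [norm_one] at this
      have : K1 / n ≤ K1 := div_le_self hK1.le hn1'
      linarith
    have hnq : 1 ≤ (n:ℝ) ^ (1/4:ℝ) := Real.one_le_rpow hn1' (by norm_num)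
    rw [eq, norm_mul, norm_mul, hcn, hXn]
    have hin : ‖(chiF (w n) / X n) * (riemannZeta (w n) - S n) + (chiF (w n) / X n - 1) * S n‖ ≤
        ((1 + K1) * K2 + K1 * K3) * ((n:ℝ) ^ (1/4:ℝ) / n) := by
      refine (norm_add_le _ _).trans ?_
      rw [norm_mul, norm_mul]
      calc _ ≤ (1 + K1) * (K2 / n) + K1 / n * (K3 * (n:ℝ) ^ (1/4:ℝ)) := by gcongr
        _ ≤ (1 + K1) * (K2 * (n:ℝ) ^ (1/4:ℝ) / n) + K1 / n * (K3 * (n:ℝ) ^ (1/4:ℝ)) := by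
          gcongr
          exact le_mul_of_one_le_right hK2.le hnq
        _ = _ := by ring
    have pw : ((n:ℝ) ^ (1 - σ))⁻¹ * (n:ℝ) ^ ((1 - σ) - 1/2) * ((n:ℝ) ^ (1/4:ℝ) / n) = 1 / (n:ℝ) ^ (5/4:ℝ) := by
      rw [← Real.rpow_neg hn0.le, ← Real.rpow_add hn0, one_div ((n:ℝ) ^ (5/4:ℝ)), ← Real.rpow_neg hn0.le,
        show (n:ℝ) ^ (1/4:ℝ) / n = (n:ℝ) ^ (1/4 - 1 : ℝ) by rw [Real.rpow_sub hn0, Real.rpow_one],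
        ← Real.rpow_add hn0]
      congr 1; ring
    calc _ ≤ ((n:ℝ) ^ (1 - σ))⁻¹ * (d ^ ((1 - σ) - 1/2) * (n:ℝ) ^ ((1 - σ) - 1/2)) *
          (((1 + K1) * K2 + K1 * K3) * ((n:ℝ) ^ (1/4:ℝ) / n)) := by gcongr
      _ = B * (((n:ℝ) ^ (1 - σ))⁻¹ * (n:ℝ) ^ ((1 - σ) - 1/2) * ((n:ℝ) ^ (1/4:ℝ) / n)) := by rw [hB]; ring
      _ = _ := by rw [pw]
  calc _ ≤ ∑ n ∈ Finset.Icc 1 N, B * (1 / (n:ℝ) ^ (5/4:ℝ)) := norm_sum_le_of_le _ tb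
    _ = B * ∑ n ∈ Finset.Icc 1 N, (1 / (n:ℝ) ^ (5/4:ℝ)) := by rw [Finset.mul_sum]
    _ ≤ B * (∑' n : ℕ, 1 / (n:ℝ) ^ (5/4:ℝ)) := by
      gcongr
      exact hsm.sum_le_tsum _ (fun n _ => by positivity)
    _ ≤ _ := by linarith
end

section
/- Let σ ≤ 0, d > 0, and θ be fixed real numbers, and fix constants C_2 > C_1 > 1. For all positive integers m, M, N with m ≤ M and C_1·N ≤ M ≤ C_2·N, the identity Σ_{n=1}^N e^{2πi F_m(n)}/n^{1/2} = ∫_1^N e^{2πi F_m(u)}/u^{1/2} du + Σ_{h≠0} (1/h) ∫_1^N (F_m′(u)/u^{1/2})·e^{2πi(F_m(u) − hu)} du + R_m holds, where the sum over h ≠ 0 is the symmetric limit lim_{H→∞} Σ_{1 ≤ |h| ≤ H}, and the remainders R_m satisfy |Σ_{m=1}^M R_m/m^{1−σ}| ≤ C for a constant C depending only on σ, d, θ, C_1, C_2. -/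
lemma step_bound (a τ : ℝ) (ha : 1 ≤ a) (hτ : 0 < τ) (m : ℕ) (hm : 1 ≤ m) :
    ‖(((m + 1 : ℕ) : ℝ) : ℂ) ^ ((-a + τ * Complex.I : ℂ) + 1) / ((-a + τ * Complex.I : ℂ) + 1)
      - ((m : ℝ) : ℂ) ^ ((-a + τ * Complex.I : ℂ) + 1) / ((-a + τ * Complex.I : ℂ) + 1)
      - ((m : ℝ) : ℂ) ^ (-a + τ * Complex.I : ℂ)‖ ≤ (a + τ) * ((m : ℝ) ^ 2)⁻¹ := by
  set s : ℂ := -a + τ * Complex.I with hs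
  have hm0 : (1 : ℝ) ≤ m := by exact_mod_cast hm
  have hsre : s.re = -a := by simp [hs]
  have hsim : s.im = τ := by simp [hs]
  have hs0 : s ≠ 0 := fun h => by rw [h] at hsim; simp at hsim; linarith
  have hs1 : s ≠ -1 := fun h => by rw [h] at hsim; simp at hsim; linarith
  have hsn : ‖s‖ ≤ a + τ := by
    refine (Complex.norm_le_abs_re_add_abs_im s).trans ?_
    rw [hsre, hsim, abs_neg, abs_of_pos hτ, abs_of_pos (by linarith)]
  have hg : ∀ x ∈ Set.Icc (m : ℝ) (m + 1),
      HasDerivWithinAt (fun y : ℝ => (y : ℂ) ^ s) (s * (x : ℂ) ^ (s - 1)) (Set.Icc (m : ℝ) (m + 1)) x := by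
    intro x hx
    have hx0 : x ≠ 0 := by linarith [hx.1]
    exact (hasDerivAt_ofReal_cpow_const hx0 hs0).hasDerivWithinAt
  have hgb : ∀ x ∈ Set.Icc (m : ℝ) (m + 1), ‖s * (x : ℂ) ^ (s - 1)‖ ≤ (a + τ) * ((m : ℝ) ^ 2)⁻¹ := by
    intro x hx
    have hx0 : 0 < x := by linarith [hx.1]
    rw [norm_mul, Complex.norm_cpow_eq_rpow_re_of_pos hx0]
    refine mul_le_mul hsn ?_ (by positivity) (by positivity)
    rw [Complex.sub_re, hsre, Complex.one_re]
    calc x ^ (-a - 1) ≤ x ^ (-2 : ℝ) :=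
          Real.rpow_le_rpow_of_exponent_le (by linarith [hx.1]) (by linarith)
      _ = (x ^ 2)⁻¹ := by rw [Real.rpow_neg hx0.le]; norm_num
      _ ≤ _ := by
        have := hx.1
        gcongr
  have hgd : ∀ x ∈ Set.Icc (m : ℝ) (m + 1),
      ‖(x : ℂ) ^ s - ((m : ℝ) : ℂ) ^ s‖ ≤ (a + τ) * ((m : ℝ) ^ 2)⁻¹ := by
    intro x hx
    have := Convex.norm_image_sub_le_of_norm_hasDerivWithin_le hg hgb (convex_Icc _ _)
      (Set.left_mem_Icc.2 (by linarith)) hx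
    refine this.trans ?_
    have h1 : ‖x - m‖ ≤ 1 := by
      rw [Real.norm_eq_abs, abs_le]; constructor <;> linarith [hx.1, hx.2]
    exact mul_le_of_le_one_right (by positivity) h1
  have hG : ∀ x ∈ Set.Icc (m : ℝ) (m + 1),
      HasDerivWithinAt (fun y : ℝ => (y : ℂ) ^ (s + 1) / (s + 1) - (y : ℂ) * ((m : ℝ) : ℂ) ^ s)
        ((x : ℂ) ^ s - ((m : ℝ) : ℂ) ^ s) (Set.Icc (m : ℝ) (m + 1)) x := by
    intro x hx
    have hx0 : x ≠ 0 := by linarith [hx.1]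
    refine HasDerivAt.hasDerivWithinAt ?_
    refine (hasDerivAt_ofReal_cpow_const' hx0 hs1).sub ?_
    simpa using (Complex.ofRealCLM.hasDerivAt (x := x)).mul_const (((m : ℝ) : ℂ) ^ s)
  have := Convex.norm_image_sub_le_of_norm_hasDerivWithin_le hG hgd (convex_Icc _ _)
      (Set.left_mem_Icc.2 (by linarith)) (Set.right_mem_Icc.2 (by linarith))
  rw [add_sub_cancel_left, norm_one, mul_one] at this
  refine le_trans (le_of_eq ?_) this
  congr 1
  push_cast
  ring

lemma G_bound (a τ : ℝ) (ha : 1 ≤ a) (hτ : 0 < τ) (m : ℕ) (hm : 1 ≤ m) :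
    ‖((m : ℝ) : ℂ) ^ ((-a + τ * Complex.I : ℂ) + 1) / ((-a + τ * Complex.I : ℂ) + 1)‖ ≤ 1 / τ := by
  have hm0 : (1 : ℝ) ≤ m := by exact_mod_cast hm
  rw [norm_div, Complex.norm_cpow_eq_rpow_re_of_pos (by linarith)]
  apply div_le_div₀ zero_le_one _ hτ
  · have := Complex.abs_im_le_norm ((-a + τ * Complex.I : ℂ) + 1)
    simp at this
    exact (le_abs_self _).trans this
  · apply Real.rpow_le_one_of_one_le_of_nonpos hm0
    simp; linarith

lemma tail_bound_s8 (a τ : ℝ) (ha : 1 ≤ a) (hτ : 0 < τ) (k M : ℕ) (hk : 1 ≤ k) (hkM : k ≤ M) :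
    ‖∑ m ∈ Finset.Ioc k M, ((m : ℝ) : ℂ) ^ (-a + τ * Complex.I : ℂ)‖ ≤ 2 / τ + (a + τ) / k := by
  set s : ℂ := -a + τ * Complex.I with hs
  set G : ℕ → ℂ := fun m => ((m : ℝ) : ℂ) ^ (s + 1) / (s + 1) with hGdef
  have tele : ∑ m ∈ Finset.Ioc k M, (G (m + 1) - G m) = G (M + 1) - G (k + 1) := by
    induction M, hkM using Nat.le_induction with
    | base => simp
    | succ n hn ih => rw [Finset.sum_Ioc_succ_top (by omega), ih]; ring
  have e : ∑ m ∈ Finset.Ioc k M, ((m : ℝ) : ℂ) ^ s =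
      (G (M + 1) - G (k + 1)) - ∑ m ∈ Finset.Ioc k M, (G (m + 1) - G m - ((m : ℝ) : ℂ) ^ s) := by
    rw [Finset.sum_sub_distrib, tele]; ring
  rw [e]
  have h1 : ‖G (M + 1)‖ ≤ 1 / τ := G_bound a τ ha hτ _ (by omega)
  have h2 : ‖G (k + 1)‖ ≤ 1 / τ := G_bound a τ ha hτ _ (by omega)
  have h3 : ‖∑ m ∈ Finset.Ioc k M, (G (m + 1) - G m - ((m : ℝ) : ℂ) ^ s)‖ ≤ (a + τ) / k := by
    calc _ ≤ ∑ m ∈ Finset.Ioc k M, (a + τ) * ((m : ℝ) ^ 2)⁻¹ := by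
          refine norm_sum_le_of_le _ fun m hm => ?_
          rw [Finset.mem_Ioc] at hm
          exact step_bound a τ ha hτ m (by omega)
      _ = (a + τ) * ∑ m ∈ Finset.Ioc k M, ((m : ℝ) ^ 2)⁻¹ := by rw [Finset.mul_sum]
      _ ≤ (a + τ) * (k : ℝ)⁻¹ := by
          refine mul_le_mul_of_nonneg_left ?_ (by linarith)
          refine (sum_Ioc_inv_sq_le_sub (by omega) hkM).trans ?_
          have : (0 : ℝ) ≤ (M : ℝ)⁻¹ := by positivity
          linarith
      _ = _ := by rw [div_eq_mul_inv]
  calc _ ≤ ‖G (M + 1)‖ + ‖G (k + 1)‖ + (a + τ) / k :=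
        (norm_sub_le _ _).trans (add_le_add (norm_sub_le _ _) h3)
    _ ≤ _ := by
      have : 2 / τ = 1 / τ + 1 / τ := by ring
      linarith

lemma head_bound (a τ : ℝ) (ha : 1 ≤ a) (k : ℕ) (u : ℝ) (hk : (k : ℝ) ≤ u) (hu : 1 ≤ u) :
    ‖∑ m ∈ Finset.Ioc 0 k, ((m : ℝ) : ℂ) ^ (-a + τ * Complex.I : ℂ)‖ ≤ 1 + Real.log u := by
  have h : ((harmonic k : ℚ) : ℝ) ≤ 1 + Real.log k := harmonic_le_one_add_log k
  have hl : Real.log k ≤ Real.log u := by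
    rcases Nat.eq_zero_or_pos k with rfl | h0
    · simpa using Real.log_nonneg hu
    · exact Real.log_le_log (by exact_mod_cast h0) hk
  refine le_trans ?_ (h.trans (by linarith))
  rw [harmonic_eq_sum_Icc]
  push_cast
  refine norm_sum_le_of_le _ fun m hm => ?_
  rw [Finset.mem_Ioc] at hm
  have hm0 : (1 : ℝ) ≤ m := by exact_mod_cast hm.1
  rw [← Complex.ofReal_natCast, Complex.norm_cpow_eq_rpow_re_of_pos (by linarith),
    ← Real.rpow_neg_one]
  apply Real.rpow_le_rpow_of_exponent_le hm0
  simp; linarith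

lemma pow_sum_bound (a d : ℝ) (ha : 1 ≤ a) (hd : 0 < d) (M : ℕ) (u : ℝ) (hu : 1 ≤ u) :
    ‖∑ m ∈ Finset.Ioc 0 M, ((m : ℝ) : ℂ) ^ (-a + (2 * Real.pi * d * u : ℝ) * Complex.I : ℂ)‖
      ≤ (5 + 2 / (2 * Real.pi * d) + 2 * (a + 2 * Real.pi * d)) * u ^ (1 / 4 : ℝ) := by
  have hu4 : (1 : ℝ) ≤ u ^ (1 / 4 : ℝ) := Real.one_le_rpow hu (by norm_num)
  have hlog : Real.log u ≤ 4 * u ^ (1 / 4 : ℝ) := by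
    have := Real.log_le_rpow_div (by linarith : 0 ≤ u) (by norm_num : (0 : ℝ) < 1 / 4)
    linarith
  have hD : 0 < 2 * Real.pi * d := by positivity
  set D := 2 * Real.pi * d with hDdef
  have hc : 0 ≤ 2 / D + 2 * (a + D) := by positivity
  have hck : 2 / D + 2 * (a + D) ≤ (2 / D + 2 * (a + D)) * u ^ (1 / 4 : ℝ) :=
    le_mul_of_one_le_right hc hu4
  have hfl : 1 ≤ ⌊u⌋₊ := by rw [Nat.one_le_floor_iff]; exact hu
  have hfl' : ((⌊u⌋₊ : ℕ) : ℝ) ≤ u := Nat.floor_le (by linarith)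
  rcases le_total M ⌊u⌋₊ with h | h
  · have := head_bound a (D * u) ha M u (le_trans (by exact_mod_cast h) hfl') hu
    refine this.trans ?_
    nlinarith
  · rw [← Finset.sum_Ioc_consecutive _ (Nat.zero_le _) h]
    refine (norm_add_le _ _).trans ?_
    have h1 := head_bound a (D * u) ha ⌊u⌋₊ u hfl' hu
    have h2 := tail_bound_s8 a (D * u) ha (by positivity) ⌊u⌋₊ M hfl h
    have h3 : 2 / (D * u) ≤ 2 / D := by
      gcongr; exact le_mul_of_one_le_right hD.le hu
    have h4 : (a + D * u) / (⌊u⌋₊ : ℕ) ≤ 2 * (a + D) := by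
      have hlt : u < (⌊u⌋₊ : ℕ) + 1 := Nat.lt_floor_add_one u
      have hfr : (1 : ℝ) ≤ (⌊u⌋₊ : ℕ) := by exact_mod_cast hfl
      rw [div_le_iff₀ (by linarith)]
      nlinarith
    nlinarith

lemma exp_Fm (d θ : ℝ) (hd : 0 < d) (m : ℕ) (hm : 1 ≤ m) (u : ℝ) (hu : 0 < u) (a : ℝ) :
    Complex.exp (2 * (Real.pi : ℂ) * Complex.I * ((Fm d θ m u : ℝ) : ℂ)) / (((m : ℝ) ^ a : ℝ) : ℂ)
    = Complex.exp (2 * (Real.pi : ℂ) * Complex.I *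
        ((d * u * Real.log (Real.exp 1 / (d * u)) + θ * u : ℝ) : ℂ)) *
      ((m : ℝ) : ℂ) ^ (-a + (2 * Real.pi * d * u : ℝ) * Complex.I : ℂ) := by
  have hm0 : (0 : ℝ) < m := by exact_mod_cast hm
  have hmc : ((m : ℝ) : ℂ) ≠ 0 := by exact_mod_cast hm0.ne'
  rw [Complex.cpow_add _ _ hmc, Complex.cpow_neg, Complex.ofReal_cpow hm0.le]
  rw [Complex.cpow_def_of_ne_zero hmc ((2 * Real.pi * d * u : ℝ) * Complex.I : ℂ),
    ← Complex.ofReal_log hm0.le]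
  have : Fm d θ m u = (d * u * Real.log (Real.exp 1 / (d * u)) + θ * u) + d * u * Real.log m := by
    unfold Fm
    rw [mul_div_right_comm, Real.log_mul (by positivity) hm0.ne']
    ring
  rw [this, div_eq_mul_inv, Complex.ofReal_add, mul_add, Complex.exp_add]
  have e : 2 * (Real.pi : ℂ) * Complex.I * ((d * u * Real.log m : ℝ) : ℂ) =
    (Real.log m : ℂ) * ((2 * Real.pi * d * u : ℝ) * Complex.I : ℂ) := by
    push_cast; ring
  rw [e]; ring

lemma norm_exp_real (x : ℝ) : ‖Complex.exp (2 * (Real.pi : ℂ) * Complex.I * (x : ℂ))‖ = 1 := by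
  have : 2 * (Real.pi : ℂ) * Complex.I * (x : ℂ) = ((2 * Real.pi * x : ℝ) : ℂ) * Complex.I := by
    push_cast; ring
  rw [this, Complex.norm_exp_ofReal_mul_I]

lemma key_bound (a d θ : ℝ) (ha : 1 ≤ a) (hd : 0 < d) (M : ℕ) (u : ℝ) (hu : 1 ≤ u) :
    ‖∑ m ∈ Finset.Icc 1 M, Complex.exp (2 * (Real.pi : ℂ) * Complex.I * ((Fm d θ m u : ℝ) : ℂ))
        / (((m : ℝ) ^ a : ℝ) : ℂ)‖
      ≤ (5 + 2 / (2 * Real.pi * d) + 2 * (a + 2 * Real.pi * d)) * u ^ (1 / 4 : ℝ) := by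
  rw [Finset.sum_congr rfl fun m hm => exp_Fm d θ hd m (Finset.mem_Icc.1 hm).1 u (by linarith) a,
    ← Finset.mul_sum, norm_mul, norm_exp_real, one_mul]
  exact pow_sum_bound a d ha hd M u hu
open Filter Topology in
lemma pt_lim (n : ℕ) (x : ℝ) (hx : x ∈ Set.Icc (n : ℝ) (n + 1)) :
    Tendsto (fun H : ℕ => ∑ h ∈ (Finset.Icc (-(H : ℤ)) (H : ℤ)).erase 0,
      1 / (h : ℂ) ^ 2 * Complex.exp (2 * (Real.pi : ℂ) * Complex.I * ((-(h : ℝ) * x : ℝ) : ℂ)))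
      atTop (𝓝 (2 * (Real.pi : ℂ) ^ 2 * (((x - n) ^ 2 - (x - n) + 1 / 6 : ℝ) : ℂ))) := by
  have hy : 1 - (x - n) ∈ Set.Icc (0 : ℝ) 1 := ⟨by linarith [hx.2], by linarith [hx.1]⟩
  have hs := hasSum_one_div_pow_mul_fourier_mul_bernoulliFun (le_refl 2) hy
  have ht : Tendsto (fun H : ℕ => Finset.Icc (-(H : ℤ)) (H : ℤ)) atTop atTop :=
    Finset.tendsto_Icc_neg_atTop_atTop.comp tendsto_natCast_atTop_atTop
  have := hs.comp ht
  convert this using 1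
  · funext H
    simp only [Function.comp]
    rw [← Finset.sum_erase (Finset.Icc (-(H : ℤ)) (H : ℤ)) (a := 0) (by simp)]
    refine Finset.sum_congr rfl fun h hh => ?_
    congr 1
    rw [fourier_coe_apply, Complex.exp_eq_exp_iff_exists_int]
    refine ⟨-h * (1 + n), ?_⟩
    push_cast
    ring
  · rw [bernoulliFun_two]
    congr 1
    have := Complex.I_sq
    push_cast
    rw [mul_pow, this]
    simp [Nat.factorial]
    ring

lemma hasDeriv_e (h : ℤ) (x : ℝ) :
    HasDerivAt (fun x : ℝ => Complex.exp (2 * (Real.pi : ℂ) * Complex.I * ((-(h : ℝ) * x : ℝ) : ℂ)))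
      (-(2 * (Real.pi : ℂ) * Complex.I * h) *
        Complex.exp (2 * (Real.pi : ℂ) * Complex.I * ((-(h : ℝ) * x : ℝ) : ℂ))) x := by
  have h1 : HasDerivAt (fun x : ℝ => 2 * (Real.pi : ℂ) * Complex.I * ((-(h : ℝ) * x : ℝ) : ℂ))
      (-(2 * (Real.pi : ℂ) * Complex.I * h)) x := by
    have := ((hasDerivAt_id x).const_mul (-(h : ℝ))).ofReal_comp.const_mul (2 * (Real.pi : ℂ) * Complex.I)
    refine this.congr_deriv ?_
    push_cast; ring
  refine h1.cexp.congr_deriv ?_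
  ring

open Filter Topology in
lemma saw (n : ℕ) (w w' : ℝ → ℂ)
    (hw : ∀ x ∈ Set.Icc (n : ℝ) (n + 1), HasDerivAt w (w' x) x)
    (hw' : ContinuousOn w' (Set.Icc (n : ℝ) (n + 1))) :
    Tendsto (fun H : ℕ => ∑ h ∈ (Finset.Icc (-(H : ℤ)) (H : ℤ)).erase 0,
      (1 / (h : ℂ)) * ∫ x in (n : ℝ)..(n + 1), w x *
        Complex.exp (2 * (Real.pi : ℂ) * Complex.I * ((-(h : ℝ) * x : ℝ) : ℂ)))
      atTop (𝓝 (2 * (Real.pi : ℂ) * Complex.I *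
        ∫ x in (n : ℝ)..(n + 1), ((x - n - 1 / 2 : ℝ) : ℂ) * w x)) := by
  have hle : (n : ℝ) ≤ n + 1 := by linarith
  have hu : Set.uIcc (n : ℝ) (n + 1) = Set.Icc (n : ℝ) (n + 1) := Set.uIcc_of_le hle
  have hwc : ContinuousOn w (Set.Icc (n : ℝ) (n + 1)) :=
    fun x hx => (hw x hx).continuousAt.continuousWithinAt
  have hpi : (2 * (Real.pi : ℂ) * Complex.I) ≠ 0 := Complex.two_pi_I_ne_zero
  set e : ℤ → ℝ → ℂ := fun h x =>
    Complex.exp (2 * (Real.pi : ℂ) * Complex.I * ((-(h : ℝ) * x : ℝ) : ℂ)) with he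
  have hec : ∀ h, Continuous (e h) := fun h =>
    continuous_iff_continuousAt.2 fun x => (hasDeriv_e h x).continuousAt
  have hen : ∀ h x, ‖e h x‖ = 1 := fun h x => norm_exp_real _
  set T : ℕ → Finset ℤ := fun H => (Finset.Icc (-(H : ℤ)) (H : ℤ)).erase 0 with hT
  set A : ℕ → ℝ → ℂ := fun H x => ∑ h ∈ T H, 1 / (h : ℂ) ^ 2 * e h x with hA
  set Φ : ℕ → ℝ → ℂ := fun H x => (2 * (Real.pi : ℂ) * Complex.I)⁻¹ *
    (A H x - 2 * (Real.pi : ℂ) ^ 2 * (((x - n) ^ 2 - (x - n) + 1 / 6 : ℝ) : ℂ)) with hΦ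
  set φ : ℕ → ℝ → ℂ := fun H x => (2 * (Real.pi : ℂ) * Complex.I) * ((x - n - 1 / 2 : ℝ) : ℂ) -
    ∑ h ∈ T H, (1 / (h : ℂ)) * e h x with hφ
  have hΦlim : ∀ x ∈ Set.Icc (n : ℝ) (n + 1), Tendsto (fun H => Φ H x) atTop (𝓝 0) := by
    intro x hx
    have := ((pt_lim n x hx).sub_const
      (2 * (Real.pi : ℂ) ^ 2 * (((x - n) ^ 2 - (x - n) + 1 / 6 : ℝ) : ℂ))).const_mul
        (2 * (Real.pi : ℂ) * Complex.I)⁻¹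
    rw [sub_self, mul_zero] at this
    exact this
  have hΦd : ∀ H x, HasDerivAt (Φ H) (φ H x) x := by
    intro H x
    have h1 : HasDerivAt (A H) (∑ h ∈ T H, 1 / (h : ℂ) ^ 2 *
        (-(2 * (Real.pi : ℂ) * Complex.I * h) * e h x)) x :=
      HasDerivAt.fun_sum fun h _ => (hasDeriv_e h x).const_mul _
    have h2 : HasDerivAt (fun x : ℝ => (x - n) ^ 2 - (x - n) + 1 / 6) (2 * (x - n) - 1) x := by
      have h3 := (hasDerivAt_id x).sub_const (n : ℝ)
      refine (((h3.pow 2).sub h3).add_const (1 / 6)).congr_deriv ?_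
      simp
    refine ((h1.sub (h2.ofReal_comp.const_mul (2 * (Real.pi : ℂ) ^ 2))).const_mul
      (2 * (Real.pi : ℂ) * Complex.I)⁻¹).congr_deriv ?_
    have e1 : ∑ h ∈ T H, 1 / (h : ℂ) ^ 2 * (-(2 * (Real.pi : ℂ) * Complex.I * h) * e h x) =
        -(2 * (Real.pi : ℂ) * Complex.I) * ∑ h ∈ T H, (1 / (h : ℂ)) * e h x := by
      rw [Finset.mul_sum]
      refine Finset.sum_congr rfl fun h hh => ?_
      have : (h : ℂ) ≠ 0 := by exact_mod_cast (Finset.mem_erase.1 hh).1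
      field_simp
    rw [e1]
    simp only [hφ]
    generalize ∑ h ∈ T H, (1 / (h : ℂ)) * e h x = S
    have hI := Complex.I_sq
    have hpi' : (Real.pi : ℂ) ≠ 0 := by exact_mod_cast Real.pi_ne_zero
    have hI0 := Complex.I_ne_zero
    push_cast
    field_simp
    linear_combination (-(Real.pi : ℂ) * (2 * (x - n) - 1)) * hI
  have hφc : ∀ H, Continuous (φ H) := by
    intro H
    simp only [hφ]
    refine Continuous.sub (by fun_prop) ?_
    exact continuous_finsetSum _ fun h _ => continuous_const.mul (hec h)
  have hΦc : ∀ H, Continuous (Φ H) := fun H =>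
    continuous_iff_continuousAt.2 fun x => (hΦd H x).continuousAt
  have parts : ∀ H, ∫ x in (n : ℝ)..(n + 1), w x * φ H x =
      w (n + 1) * Φ H (n + 1) - w n * Φ H n - ∫ x in (n : ℝ)..(n + 1), w' x * Φ H x := by
    intro H
    refine intervalIntegral.integral_mul_deriv_eq_deriv_mul (by rwa [hu]) (fun x _ => hΦd H x) ?_ ?_
    · exact ContinuousOn.intervalIntegrable (by rwa [hu])
    · exact (hφc H).intervalIntegrable _ _
  obtain ⟨B, hB⟩ : ∃ B, ∀ H, ∀ x ∈ Set.Icc (n : ℝ) (n + 1), ‖Φ H x‖ ≤ B := by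
    have hsum : Summable (fun h : ℤ => 1 / (h : ℝ) ^ 2) :=
      Real.summable_one_div_int_pow.2 (by norm_num)
    refine ⟨‖(2 * (Real.pi : ℂ) * Complex.I)⁻¹‖ * ((∑' h : ℤ, 1 / (h : ℝ) ^ 2) +
      ‖2 * (Real.pi : ℂ) ^ 2‖ * 2), fun H x hx => ?_⟩
    simp only [hΦ]
    rw [norm_mul]
    refine mul_le_mul_of_nonneg_left ?_ (norm_nonneg _)
    refine (norm_sub_le _ _).trans (add_le_add ?_ ?_)
    · refine (norm_sum_le _ _).trans ?_
      refine le_trans (le_of_eq ?_) (hsum.sum_le_tsum (T H) fun i _ => by positivity)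
      refine Finset.sum_congr rfl fun h _ => ?_
      rw [norm_mul, hen]; simp
    · rw [norm_mul]
      refine mul_le_mul_of_nonneg_left ?_ (norm_nonneg _)
      rw [Complex.norm_real, Real.norm_eq_abs, abs_le]
      constructor <;> nlinarith [hx.1, hx.2]
  have hint : Tendsto (fun H => ∫ x in (n : ℝ)..(n + 1), w' x * Φ H x) atTop (𝓝 0) := by
    have := intervalIntegral.tendsto_integral_filter_of_dominated_convergence
      (μ := MeasureTheory.volume) (a := (n : ℝ)) (b := n + 1) (l := atTop)
      (F := fun H x => w' x * Φ H x) (f := fun _ => 0) (fun x => ‖w' x‖ * B) ?_ ?_ ?_ ?_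
    · simpa using this
    · refine Eventually.of_forall fun H => ?_
      rw [Set.uIoc_of_le hle]
      exact ((hw'.mul (hΦc H).continuousOn).mono Set.Ioc_subset_Icc_self).aestronglyMeasurable
        measurableSet_Ioc
    · refine Eventually.of_forall fun H => Eventually.of_forall fun x hx => ?_
      rw [Set.uIoc_of_le hle] at hx
      rw [norm_mul]
      exact mul_le_mul_of_nonneg_left (hB H x (Set.Ioc_subset_Icc_self hx)) (norm_nonneg _)
    · refine ContinuousOn.intervalIntegrable ?_
      rw [hu]
      exact hw'.norm.mul continuousOn_const
    · refine Eventually.of_forall fun x hx => ?_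
      rw [Set.uIoc_of_le hle] at hx
      simpa using (hΦlim x (Set.Ioc_subset_Icc_self hx)).const_mul (w' x)
  have hlim : Tendsto (fun H => ∫ x in (n : ℝ)..(n + 1), w x * φ H x) atTop (𝓝 0) := by
    simp only [parts]
    have h1 := (hΦlim (n + 1) ⟨hle, le_refl _⟩).const_mul (w (n + 1))
    have h2 := (hΦlim n ⟨le_refl _, hle⟩).const_mul (w n)
    simpa using (h1.sub h2).sub hint
  have hexp : ∀ H, ∑ h ∈ T H, (1 / (h : ℂ)) * ∫ x in (n : ℝ)..(n + 1), w x * e h x =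
      2 * (Real.pi : ℂ) * Complex.I * (∫ x in (n : ℝ)..(n + 1), ((x - n - 1 / 2 : ℝ) : ℂ) * w x)
      - ∫ x in (n : ℝ)..(n + 1), w x * φ H x := by
    intro H
    have i1 : ∀ h : ℤ, IntervalIntegrable (fun x => (1 / (h : ℂ)) * (w x * e h x))
        MeasureTheory.volume (n : ℝ) (n + 1) := fun h => by
      refine ContinuousOn.intervalIntegrable ?_
      rw [hu]
      exact continuousOn_const.mul (hwc.mul (hec h).continuousOn)
    have i2 : IntervalIntegrable (fun x : ℝ => 2 * (Real.pi : ℂ) * Complex.I *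
        (((x - n - 1 / 2 : ℝ) : ℂ) * w x)) MeasureTheory.volume (n : ℝ) (n + 1) := by
      refine ContinuousOn.intervalIntegrable ?_
      rw [hu]
      exact continuousOn_const.mul (ContinuousOn.mul (by fun_prop) hwc)
    have i3 : IntervalIntegrable (fun x : ℝ => w x * φ H x) MeasureTheory.volume (n : ℝ) (n + 1) := by
      refine ContinuousOn.intervalIntegrable ?_
      rw [hu]
      exact hwc.mul (hφc H).continuousOn
    simp only [← intervalIntegral.integral_const_mul]
    rw [← intervalIntegral.integral_finsetSum fun h _ => i1 h, ← intervalIntegral.integral_sub i2 i3]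
    refine intervalIntegral.integral_congr fun x _ => ?_
    simp only [hφ, mul_sub, Finset.mul_sum]
    rw [sub_sub_eq_add_sub]
    have : ∑ h ∈ T H, w x * (1 / (h : ℂ) * e h x) = ∑ h ∈ T H, (1 / (h : ℂ)) * (w x * e h x) :=
      Finset.sum_congr rfl fun h _ => by ring
    rw [this]; ring
  refine Tendsto.congr (fun H => (hexp H).symm) ?_
  simpa using hlim.const_sub (2 * (Real.pi : ℂ) * Complex.I *
    (∫ x in (n : ℝ)..(n + 1), ((x - n - 1 / 2 : ℝ) : ℂ) * w x))


open Filter Topology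

lemma euler_mac (f f' : ℝ → ℂ) (hf : ∀ x : ℝ, 1 ≤ x → HasDerivAt f (f' x) x)
    (hf' : ContinuousOn f' (Set.Ici 1)) (N : ℕ) (hN : 1 ≤ N) :
    (∑ n ∈ Finset.Icc 1 N, f n) - (∫ x in (1 : ℝ)..N, f x) =
      (f 1 + f N) / 2 + ∑ n ∈ Finset.Ico 1 N,
        ∫ x in (n : ℝ)..(n + 1), ((x - n - 1 / 2 : ℝ) : ℂ) * f' x := by
  have hfc : ContinuousOn f (Set.Ici 1) := fun x hx => (hf x hx).continuousAt.continuousWithinAt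
  induction N, hN using Nat.le_induction with
  | base => simp
  | succ n hn ih =>
    have hn1 : (1 : ℝ) ≤ n := by exact_mod_cast hn
    have hsub : Set.uIcc (n : ℝ) (n + 1) ⊆ Set.Ici 1 := by
      rw [Set.uIcc_of_le (by linarith)]
      exact fun x hx => le_trans hn1 hx.1
    have hsub1 : Set.uIcc (1 : ℝ) n ⊆ Set.Ici 1 := by
      rw [Set.uIcc_of_le hn1]
      exact fun x hx => hx.1
    have hp := intervalIntegral.integral_mul_deriv_eq_deriv_mul (a := (n : ℝ)) (b := n + 1)
      (u := fun x : ℝ => ((x - n - 1 / 2 : ℝ) : ℂ)) (u' := fun _ => 1) (v := f) (v' := f')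
      (fun x _ => by
        simpa using (((hasDerivAt_id x).sub_const (n : ℝ)).sub_const (1 / 2)).ofReal_comp)
      (fun x hx => hf x (hsub hx)) (by simp) (hf'.mono hsub).intervalIntegrable
    have hadj := intervalIntegral.integral_add_adjacent_intervals
      (hfc.mono hsub1).intervalIntegrable (hfc.mono hsub).intervalIntegrable (μ := MeasureTheory.volume)
    rw [Finset.sum_Icc_succ_top (by omega), Finset.sum_Ico_succ_top hn, hp]
    push_cast at ih ⊢
    rw [← hadj]
    simp only [one_mul]
    linear_combination ih

lemma hasDeriv_Fm (d θ : ℝ) (hd : 0 < d) (m : ℕ) (hm : 1 ≤ m) (x : ℝ) (hx : 0 < x) :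
    HasDerivAt (Fm d θ m) (d * Real.log (m / (d * x)) + θ) x := by
  have hm0 : (0 : ℝ) < m := by exact_mod_cast hm
  have h1 : HasDerivAt (fun u : ℝ => d * u * (1 + Real.log m - Real.log d - Real.log u) + θ * u)
      (d * Real.log (m / (d * x)) + θ) x := by
    have := (((hasDerivAt_id x).const_mul d).mul
      ((Real.hasDerivAt_log hx.ne').const_sub (1 + Real.log m - Real.log d))).add
      ((hasDerivAt_id x).const_mul θ)
    refine this.congr_deriv ?_
    rw [Real.log_div hm0.ne' (by positivity), Real.log_mul hd.ne' hx.ne']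
    simp
    field_simp
    ring
  refine h1.congr_of_eventuallyEq ?_
  filter_upwards [lt_mem_nhds hx] with u hu
  unfold Fm
  rw [Real.log_div (by positivity) (by positivity), Real.log_mul (by positivity) hm0.ne',
    Real.log_mul hd.ne' hu.ne', Real.log_exp]
  ring

/-- exponential -/
noncomputable def EE (d θ : ℝ) (m : ℕ) (x : ℝ) : ℂ :=
  Complex.exp (2 * (Real.pi : ℂ) * Complex.I * ((Fm d θ m x : ℝ) : ℂ))

/-- weight -/
noncomputable def WW (d θ : ℝ) (m : ℕ) (x : ℝ) : ℂ :=
  ((((d * Real.log (m / (d * x)) + θ) / Real.sqrt x : ℝ)) : ℂ) * EE d θ m x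

lemma hasDeriv_EE (d θ : ℝ) (hd : 0 < d) (m : ℕ) (hm : 1 ≤ m) (x : ℝ) (hx : 0 < x) :
    HasDerivAt (EE d θ m) (2 * (Real.pi : ℂ) * Complex.I *
      ((d * Real.log (m / (d * x)) + θ : ℝ) : ℂ) * EE d θ m x) x := by
  have := ((hasDeriv_Fm d θ hd m hm x hx).ofReal_comp.const_mul (2 * (Real.pi : ℂ) * Complex.I)).cexp
  refine this.congr_deriv ?_
  unfold EE
  ring

lemma hasDeriv_ff (d θ : ℝ) (hd : 0 < d) (m : ℕ) (hm : 1 ≤ m) (x : ℝ) (hx : 0 < x) :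
    HasDerivAt (fun x => EE d θ m x / ((Real.sqrt x : ℝ) : ℂ))
      (2 * (Real.pi : ℂ) * Complex.I * WW d θ m x
        - 1 / 2 * (((1 / (x * Real.sqrt x) : ℝ) : ℂ) * EE d θ m x)) x := by
  have hs : 0 < Real.sqrt x := Real.sqrt_pos.2 hx
  have hsc : ((Real.sqrt x : ℝ) : ℂ) ≠ 0 := by exact_mod_cast hs.ne'
  have hxs : (x : ℂ) = ((Real.sqrt x : ℝ) : ℂ) ^ 2 := by
    rw [← Complex.ofReal_pow, Real.sq_sqrt hx.le]
  refine ((hasDeriv_EE d θ hd m hm x hx).div (Real.hasDerivAt_sqrt hx.ne').ofReal_comp hsc).congr_deriv ?_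
  unfold WW
  push_cast
  rw [hxs]
  field_simp

lemma WW_smooth (d θ : ℝ) (hd : 0 < d) (m : ℕ) (hm : 1 ≤ m) :
    ContDiffOn ℝ 1 (WW d θ m) (Set.Ioi 0) := by
  have hm0 : (0 : ℝ) < m := by exact_mod_cast hm
  intro x hx
  have hx : 0 < x := hx
  refine ContDiffAt.contDiffWithinAt ?_
  have hof : ContDiff ℝ 1 (fun x : ℝ => (x : ℂ)) := Complex.ofRealCLM.contDiff
  have h1 : ContDiffAt ℝ 1 (fun x : ℝ => (m : ℝ) / (d * x)) x :=
    contDiffAt_const.div (contDiffAt_const.mul contDiffAt_id) (by positivity)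
  have h2 : ContDiffAt ℝ 1 (fun x : ℝ => Real.exp 1 * (m : ℝ) / (d * x)) x :=
    contDiffAt_const.div (contDiffAt_const.mul contDiffAt_id) (by positivity)
  have h3 : ContDiffAt ℝ 1 (fun x : ℝ => (d * Real.log (m / (d * x)) + θ) / Real.sqrt x) x :=
    ((contDiffAt_const.mul (h1.log (by positivity))).add contDiffAt_const).div
      (contDiffAt_id.sqrt hx.ne') (Real.sqrt_pos.2 hx).ne'
  have h4 : ContDiffAt ℝ 1 (Fm d θ m) x :=
    ((contDiffAt_const.mul contDiffAt_id).mul (h2.log (by positivity))).add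
      (contDiffAt_const.mul contDiffAt_id)
  have h5 : ContDiffAt ℝ 1 (EE d θ m) x :=
    (contDiffAt_const.mul (hof.contDiffAt.comp x h4)).cexp
  exact (hof.contDiffAt.comp x h3).mul h5

lemma lim_lemma (d θ : ℝ) (hd : 0 < d) (m : ℕ) (hm : 1 ≤ m) (N : ℕ) (hN : 1 ≤ N) :
    Tendsto (fun H : ℕ =>
        ∑ h ∈ (Finset.Icc (-(H : ℤ)) (H : ℤ)).erase 0,
          (1 / (h : ℂ)) *
            ∫ x in (1 : ℝ)..(N : ℝ),
              ((((d * Real.log (m / (d * x)) + θ) / Real.sqrt x : ℝ)) : ℂ) *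
                Complex.exp (2 * (Real.pi : ℂ) * Complex.I *
                  ((Fm d θ m x - (h : ℝ) * x : ℝ) : ℂ))) atTop
      (𝓝 (∑ n ∈ Finset.Ico 1 N, 2 * (Real.pi : ℂ) * Complex.I *
        ∫ x in (n : ℝ)..(n + 1), ((x - n - 1 / 2 : ℝ) : ℂ) * WW d θ m x)) := by
  have hW := WW_smooth d θ hd m hm
  have hlim : ∀ n ∈ Finset.Ico 1 N, _ := fun n hn => by
    have hn1 : (1 : ℝ) ≤ n := by exact_mod_cast (Finset.mem_Ico.1 hn).1
    exact saw n (WW d θ m) (deriv (WW d θ m))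
      (fun x hx => ((hW.differentiableOn one_ne_zero).differentiableAt
        (Ioi_mem_nhds (by linarith [hx.1]))).hasDerivAt)
      ((hW.continuousOn_deriv_of_isOpen isOpen_Ioi le_rfl).mono
        fun x hx => by have := hx.1; simp only [Set.mem_Ioi]; linarith)
  have := tendsto_finsetSum _ hlim
  refine this.congr fun H => ?_
  rw [Finset.sum_comm]
  refine Finset.sum_congr rfl fun h _ => ?_
  rw [← Finset.mul_sum]
  congr 1
  have hc : ContinuousOn (fun x : ℝ => WW d θ m x *
      Complex.exp (2 * (Real.pi : ℂ) * Complex.I * ((-(h : ℝ) * x : ℝ) : ℂ))) (Set.Ioi 0) :=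
    hW.continuousOn.mul (by fun_prop)
  have hadj := intervalIntegral.sum_integral_adjacent_intervals_Ico (a := fun k : ℕ => (k : ℝ))
    (μ := MeasureTheory.volume) (f := fun x : ℝ => WW d θ m x *
      Complex.exp (2 * (Real.pi : ℂ) * Complex.I * ((-(h : ℝ) * x : ℝ) : ℂ))) hN
    (fun k hk => by
      refine ContinuousOn.intervalIntegrable (hc.mono ?_)
      have hk1 : (1 : ℝ) ≤ k := by exact_mod_cast hk.1
      rw [Set.uIcc_of_le (by push_cast; linarith)]
      intro x hx
      have := hx.1
      simp only [Set.mem_Ioi]; linarith)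
  push_cast at hadj ⊢
  rw [hadj]
  refine intervalIntegral.integral_congr fun x _ => ?_
  simp only [WW, EE]
  rw [mul_assoc, ← Complex.exp_add]
  push_cast
  congr 2
  ring

lemma EE_cont (d θ : ℝ) (hd : 0 < d) (m : ℕ) (hm : 1 ≤ m) : ContinuousOn (EE d θ m) (Set.Ici 1) :=
  fun x hx => (hasDeriv_EE d θ hd m hm x
    (lt_of_lt_of_le one_pos hx)).continuousAt.continuousWithinAt

/-- remainder -/
noncomputable def RR (d θ : ℝ) (N m : ℕ) : ℂ :=
  (EE d θ m 1 + EE d θ m N / ((Real.sqrt N : ℝ) : ℂ)) / 2 - 1 / 2 * ∑ n ∈ Finset.Ico 1 N,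
    ∫ x in (n : ℝ)..(n + 1), (((x - n - 1 / 2) * (1 / (x * Real.sqrt x)) : ℝ) : ℂ) * EE d θ m x

lemma r_cont (n : ℕ) : ContinuousOn
    (fun x : ℝ => (((x - n - 1 / 2) * (1 / (x * Real.sqrt x)) : ℝ) : ℂ)) (Set.Ici 1) := by
  refine Complex.continuous_ofReal.comp_continuousOn ?_
  refine ContinuousOn.mul (by fun_prop) (continuousOn_const.div (by fun_prop) ?_)
  intro x hx
  have : 0 < x := lt_of_lt_of_le one_pos hx
  have := Real.sqrt_pos.2 this
  positivity

lemma sub_Ici (n : ℕ) (hn : 1 ≤ n) : Set.uIcc (n : ℝ) (n + 1) ⊆ Set.Ici 1 := by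
  have hn1 : (1 : ℝ) ≤ n := by exact_mod_cast hn
  rw [Set.uIcc_of_le (by linarith)]
  exact fun x hx => le_trans hn1 hx.1

lemma identity (d θ : ℝ) (hd : 0 < d) (m : ℕ) (hm : 1 ≤ m) (N : ℕ) (hN : 1 ≤ N) :
    ∑ n ∈ Finset.Ico 1 N, 2 * (Real.pi : ℂ) * Complex.I *
        (∫ x in (n : ℝ)..(n + 1), ((x - n - 1 / 2 : ℝ) : ℂ) * WW d θ m x) =
      (∑ n ∈ Finset.Icc 1 N, EE d θ m n / ((Real.sqrt n : ℝ) : ℂ))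
        - (∫ x in (1 : ℝ)..(N : ℝ), EE d θ m x / ((Real.sqrt x : ℝ) : ℂ)) - RR d θ N m := by
  have hEc := EE_cont d θ hd m hm
  have hWc : ContinuousOn (WW d θ m) (Set.Ici 1) :=
    (WW_smooth d θ hd m hm).continuousOn.mono fun x hx =>
      Set.mem_Ioi.2 (lt_of_lt_of_le one_pos (Set.mem_Ici.1 hx))
  have hrc : ContinuousOn (fun x : ℝ => ((1 / (x * Real.sqrt x) : ℝ) : ℂ)) (Set.Ici 1) := by
    refine Complex.continuous_ofReal.comp_continuousOn (continuousOn_const.div (by fun_prop) ?_)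
    intro x hx
    have : 0 < x := lt_of_lt_of_le one_pos hx
    have := Real.sqrt_pos.2 this
    positivity
  rw [euler_mac (fun x => EE d θ m x / ((Real.sqrt x : ℝ) : ℂ)) _
    (fun x hx => hasDeriv_ff d θ hd m hm x (by linarith))
    ((continuousOn_const.mul hWc).sub (continuousOn_const.mul (hrc.mul hEc))) N hN]
  unfold RR
  have : ∀ n ∈ Finset.Ico 1 N, (∫ x in (n : ℝ)..(n + 1), ((x - n - 1 / 2 : ℝ) : ℂ) *
      (2 * (Real.pi : ℂ) * Complex.I * WW d θ m x
        - 1 / 2 * (((1 / (x * Real.sqrt x) : ℝ) : ℂ) * EE d θ m x))) =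
      2 * (Real.pi : ℂ) * Complex.I *
        (∫ x in (n : ℝ)..(n + 1), ((x - n - 1 / 2 : ℝ) : ℂ) * WW d θ m x) -
      1 / 2 * ∫ x in (n : ℝ)..(n + 1),
        (((x - n - 1 / 2) * (1 / (x * Real.sqrt x)) : ℝ) : ℂ) * EE d θ m x := by
    intro n hn
    have hsub := sub_Ici n (Finset.mem_Ico.1 hn).1
    rw [← intervalIntegral.integral_const_mul, ← intervalIntegral.integral_const_mul,
      ← intervalIntegral.integral_sub]
    · refine intervalIntegral.integral_congr fun x _ => ?_
      simp only [Complex.ofReal_mul]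
      ring
    · refine ContinuousOn.intervalIntegrable (ContinuousOn.mono ?_ hsub)
      exact continuousOn_const.mul (ContinuousOn.mul (by fun_prop) hWc)
    · refine ContinuousOn.intervalIntegrable (ContinuousOn.mono ?_ hsub)
      exact continuousOn_const.mul ((r_cont n).mul hEc)
  rw [Finset.sum_congr rfl this, Finset.sum_sub_distrib, ← Finset.mul_sum, ← Finset.mul_sum]
  simp only [Real.sqrt_one, Complex.ofReal_one, div_one]
  ring

lemma RR_sum (d θ a : ℝ) (hd : 0 < d) (M N : ℕ) :
    ∑ m ∈ Finset.Icc 1 M, RR d θ N m / (((m : ℝ) ^ a : ℝ) : ℂ) =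
      ((∑ m ∈ Finset.Icc 1 M, EE d θ m 1 / (((m : ℝ) ^ a : ℝ) : ℂ)) +
        (∑ m ∈ Finset.Icc 1 M, EE d θ m N / (((m : ℝ) ^ a : ℝ) : ℂ)) / ((Real.sqrt N : ℝ) : ℂ)) / 2
      - 1 / 2 * ∑ n ∈ Finset.Ico 1 N, ∫ x in (n : ℝ)..(n + 1),
        (((x - n - 1 / 2) * (1 / (x * Real.sqrt x)) : ℝ) : ℂ) *
          ∑ m ∈ Finset.Icc 1 M, EE d θ m x / (((m : ℝ) ^ a : ℝ) : ℂ) := by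
  have : ∀ n ∈ Finset.Ico 1 N, (∫ x in (n : ℝ)..(n + 1),
        (((x - n - 1 / 2) * (1 / (x * Real.sqrt x)) : ℝ) : ℂ) *
          ∑ m ∈ Finset.Icc 1 M, EE d θ m x / (((m : ℝ) ^ a : ℝ) : ℂ)) =
      ∑ m ∈ Finset.Icc 1 M, (((m : ℝ) ^ a : ℝ) : ℂ)⁻¹ * ∫ x in (n : ℝ)..(n + 1),
        (((x - n - 1 / 2) * (1 / (x * Real.sqrt x)) : ℝ) : ℂ) * EE d θ m x := by
    intro n hn
    have hsub := sub_Ici n (Finset.mem_Ico.1 hn).1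
    simp only [← intervalIntegral.integral_const_mul]
    rw [← intervalIntegral.integral_finsetSum]
    · refine intervalIntegral.integral_congr fun x _ => ?_
      simp only [Finset.mul_sum]
      exact Finset.sum_congr rfl fun m _ => by ring
    · intro m hm
      refine ContinuousOn.intervalIntegrable (ContinuousOn.mono ?_ hsub)
      exact continuousOn_const.mul ((r_cont n).mul (EE_cont d θ hd m (Finset.mem_Icc.1 hm).1))
  rw [Finset.sum_congr rfl this, Finset.sum_comm, Finset.sum_div, ← Finset.sum_add_distrib,
    Finset.sum_div, Finset.mul_sum, ← Finset.sum_sub_distrib]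
  refine Finset.sum_congr rfl fun m _ => ?_
  rw [← Finset.mul_sum]
  unfold RR
  ring

lemma final_bound (d θ a : ℝ) (hd : 0 < d) (ha : 1 ≤ a) (M N : ℕ) (hN : 1 ≤ N) (K : ℝ)
    (hK : K = 5 + 2 / (2 * Real.pi * d) + 2 * (a + 2 * Real.pi * d)) :
    ‖∑ m ∈ Finset.Icc 1 M, RR d θ N m / (((m : ℝ) ^ a : ℝ) : ℂ)‖ ≤
      K + K * ∑' n : ℕ, 1 / (n : ℝ) ^ (5 / 4 : ℝ) := by
  have hK0 : 0 < K := by rw [hK]; positivity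
  have hS : ∀ x : ℝ, 1 ≤ x →
      ‖∑ m ∈ Finset.Icc 1 M, EE d θ m x / (((m : ℝ) ^ a : ℝ) : ℂ)‖ ≤ K * x ^ (1 / 4 : ℝ) :=
    fun x hx => hK ▸ key_bound a d θ ha hd M x hx
  have hsum : Summable (fun n : ℕ => 1 / (n : ℝ) ^ (5 / 4 : ℝ)) :=
    Real.summable_one_div_nat_rpow.2 (by norm_num)
  have hN1 : (1 : ℝ) ≤ N := by exact_mod_cast hN
  have h1 := hS 1 le_rfl
  rw [Real.one_rpow, mul_one] at h1
  have h2 : ‖(∑ m ∈ Finset.Icc 1 M, EE d θ m N / (((m : ℝ) ^ a : ℝ) : ℂ)) /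
      ((Real.sqrt N : ℝ) : ℂ)‖ ≤ K := by
    have hs : 0 < Real.sqrt N := Real.sqrt_pos.2 (by linarith)
    rw [norm_div, Complex.norm_real, Real.norm_eq_abs, abs_of_pos hs, div_le_iff₀ hs]
    refine (hS N hN1).trans (mul_le_mul_of_nonneg_left ?_ hK0.le)
    rw [Real.sqrt_eq_rpow]
    exact Real.rpow_le_rpow_of_exponent_le hN1 (by norm_num)
  have h3 : ‖∑ n ∈ Finset.Ico 1 N, ∫ x in (n : ℝ)..(n + 1),
        (((x - n - 1 / 2) * (1 / (x * Real.sqrt x)) : ℝ) : ℂ) *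
          ∑ m ∈ Finset.Icc 1 M, EE d θ m x / (((m : ℝ) ^ a : ℝ) : ℂ)‖ ≤
      K * ∑' n : ℕ, 1 / (n : ℝ) ^ (5 / 4 : ℝ) := by
    refine le_trans ?_ (mul_le_mul_of_nonneg_left
      (hsum.sum_le_tsum (Finset.Ico 1 N) fun i _ => by positivity) hK0.le)
    rw [Finset.mul_sum]
    refine norm_sum_le_of_le _ fun n hn => ?_
    have hn1 : (1 : ℝ) ≤ n := by exact_mod_cast (Finset.mem_Ico.1 hn).1
    have := intervalIntegral.norm_integral_le_of_norm_le_const (a := (n : ℝ)) (b := n + 1)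
      (C := K * (1 / (n : ℝ) ^ (5 / 4 : ℝ))) (f := fun x : ℝ =>
        (((x - n - 1 / 2) * (1 / (x * Real.sqrt x)) : ℝ) : ℂ) *
          ∑ m ∈ Finset.Icc 1 M, EE d θ m x / (((m : ℝ) ^ a : ℝ) : ℂ)) ?_
    · simpa using this
    · intro x hx
      rw [Set.uIoc_of_le (by linarith)] at hx
      have hx1 : 1 ≤ x := by linarith [hx.1]
      have hx0 : 0 < x := by linarith
      have hs : 0 < Real.sqrt x := Real.sqrt_pos.2 hx0
      rw [norm_mul, Complex.norm_real, Real.norm_eq_abs, abs_mul,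
        abs_of_pos (by positivity : 0 < 1 / (x * Real.sqrt x))]
      have hab : |x - n - 1 / 2| ≤ 1 := by
        rw [abs_le]; constructor <;> linarith [hx.1, hx.2]
      have e1 : 1 / (x * Real.sqrt x) = x ^ (-(3 / 2) : ℝ) := by
        rw [Real.rpow_neg hx0.le, Real.sqrt_eq_rpow, one_div]
        congr 1
        rw [← Real.rpow_one_add' hx0.le (by norm_num)]
        norm_num
      calc |x - n - 1 / 2| * (1 / (x * Real.sqrt x)) *
            ‖∑ m ∈ Finset.Icc 1 M, EE d θ m x / (((m : ℝ) ^ a : ℝ) : ℂ)‖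
          ≤ 1 * (1 / (x * Real.sqrt x)) * (K * x ^ (1 / 4 : ℝ)) := by
            gcongr
            exact hS x hx1
        _ = K * (x ^ (-(3 / 2) : ℝ) * x ^ (1 / 4 : ℝ)) := by rw [e1]; ring
        _ = K * (1 / x ^ (5 / 4 : ℝ)) := by
            rw [← Real.rpow_add hx0, one_div (x ^ (5 / 4 : ℝ)), ← Real.rpow_neg hx0.le]; norm_num
        _ ≤ K * (1 / (n : ℝ) ^ (5 / 4 : ℝ)) := by
            have := hx.1.le
            gcongr
  rw [RR_sum d θ a hd M N]
  refine (norm_sub_le _ _).trans (add_le_add ?_ ?_)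
  · rw [norm_div, Complex.norm_ofNat, div_le_iff₀ (by norm_num)]
    refine (norm_add_le _ _).trans ?_
    linarith
  · rw [norm_mul]
    refine le_trans ?_ h3
    exact mul_le_of_le_one_left (norm_nonneg _) (by norm_num)

theorem statement8 (σ d θ C1 C2 : ℝ) (hσ : σ ≤ 0) (hd : 0 < d)
    (hC1 : 1 < C1) (hC12 : C1 < C2) :
    ∃ C > (0 : ℝ), ∀ M N : ℕ, 0 < M → 0 < N → C1 * N ≤ M → (M : ℝ) ≤ C2 * N →
      ∃ R : ℕ → ℂ,
        (∀ m : ℕ, 1 ≤ m → m ≤ M →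
          Filter.Tendsto
            (fun H : ℕ =>
              ∑ h ∈ (Finset.Icc (-(H : ℤ)) (H : ℤ)).erase 0,
                (1 / (h : ℂ)) *
                  ∫ x in (1 : ℝ)..(N : ℝ),
                    ((((d * Real.log (m / (d * x)) + θ) / Real.sqrt x : ℝ)) : ℂ) *
                      Complex.exp (2 * (Real.pi : ℂ) * Complex.I *
                        ((Fm d θ m x - (h : ℝ) * x : ℝ) : ℂ)))
            Filter.atTop
            (nhds ((∑ n ∈ Finset.Icc 1 N,
                Complex.exp (2 * (Real.pi : ℂ) * Complex.I * ((Fm d θ m n : ℝ) : ℂ)) /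
                  ((Real.sqrt n : ℝ) : ℂ))
              - (∫ x in (1 : ℝ)..(N : ℝ),
                  Complex.exp (2 * (Real.pi : ℂ) * Complex.I * ((Fm d θ m x : ℝ) : ℂ)) /
                    ((Real.sqrt x : ℝ) : ℂ))
              - R m))) ∧
        ‖∑ m ∈ Finset.Icc 1 M, R m / ((((m : ℝ) ^ (1 - σ) : ℝ)) : ℂ)‖ ≤ C := by
  have ha : (1 : ℝ) ≤ 1 - σ := by linarith
  have hts : 0 ≤ ∑' n : ℕ, 1 / (n : ℝ) ^ (5 / 4 : ℝ) := tsum_nonneg fun n => by positivity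
  obtain ⟨K, hK⟩ : ∃ K, K = 5 + 2 / (2 * Real.pi * d) + 2 * ((1 - σ) + 2 * Real.pi * d) := ⟨_, rfl⟩
  have hK0 : 0 < K := by
    have : 0 < 1 - σ := by linarith
    rw [hK]; positivity
  refine ⟨K + K * ∑' n : ℕ, 1 / (n : ℝ) ^ (5 / 4 : ℝ), by positivity, ?_⟩
  intro M N _ hN _ _
  refine ⟨RR d θ N, fun m hm _ => ?_, final_bound d θ (1 - σ) hd ha M N hN K hK⟩
  have h := lim_lemma d θ hd m hm N hN
  rw [identity d θ hd m hm N hN] at h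
  exact h
end
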